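/- arXiv:1706.03670 — 5 statements merged into one kernel-verified Lean document; each statement's English description precedes it below -/
import Mathlib

section
/- Let Q : ℝ^n → ℝ be a polynomial of degree at most d and let L_Q : (ℝ^n)^d → ℝ be a map that is affine in each of its d vector variables, symmetric under permutation of its d variables, and satisfies L_Q(x, …, x) = Q(x) for all x ∈ ℝ^n. Then for each integer 0 ≤ m ≤ d/2, sup_{x,y ∈ [-1,1]^n} |L_Q(x, …, x, y, …, y)| ≤ 2 d^m · sup_{x ∈ [-1,1]^n} |Q(x)|, where x appears m times and y appears d−m times. -/
open Finset

/-- The sup norm of a real polynomial in `n` variables over the cube `[-1,1]^n`. -/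
noncomputable def supOnBox {n : ℕ} (P : MvPolynomial (Fin n) ℝ) : ℝ :=
  sSup {y : ℝ | ∃ x : Fin n → ℝ, (∀ i, x i ∈ Set.Icc (-1 : ℝ) 1) ∧
    y = |MvPolynomial.eval x P|}

theorem neg_one_pow_mul_coeff_prod_X_sub_C_nonneg {ι : Type*} [DecidableEq ι] (s : Finset ι)
    (z : ι → ℝ) (hz : ∀ i ∈ s, 0 ≤ z i) (m : ℕ) :
    0 ≤ (-1 : ℝ) ^ (#s + m) * (∏ i ∈ s, (Polynomial.X - Polynomial.C (z i))).coeff m := by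
  induction s using Finset.induction_on generalizing m with
  | empty =>
    rcases m with _ | m
    · simp
    · simp [Polynomial.coeff_one]
  | insert a s ha ih =>
    have ih' := ih fun i hi => hz i (mem_insert_of_mem hi)
    have hza := hz a (mem_insert_self a s)
    rw [prod_insert ha, card_insert_of_notMem ha, sub_mul, Polynomial.coeff_sub,
      Polynomial.coeff_C_mul]
    rcases m with _ | m
    · have h := mul_nonneg hza (ih' 0)
      rw [Polynomial.mul_coeff_zero, Polynomial.coeff_X_zero]
      exact h.trans_eq (by ring)
    · have h := add_nonneg (ih' m) (mul_nonneg hza (ih' (m + 1)))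
      rw [Polynomial.coeff_X_mul]
      exact h.trans_eq (by ring)

theorem neg_one_pow_mul_prod_inv_sub_nonneg {d : ℕ} {z : ℕ → ℝ}
    (hz : StrictMonoOn z (Set.Iio d)) {j : ℕ} (hj : j < d) :
    0 ≤ (-1 : ℝ) ^ (d + j + 1) * ∏ i ∈ (range d).erase j, (z j - z i)⁻¹ := by
  have hsign : ∏ i ∈ (range d).erase j, (if j < i then (-1 : ℝ) else 1) = (-1) ^ (d + j + 1) := by
    have hfilter : ((range d).erase j).filter (fun i => j < i) = Ioo j d := by
      ext i
      simp only [mem_filter, mem_erase, mem_range, mem_Ioo]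
      omega
    rw [prod_ite, prod_const, prod_const_one, mul_one, hfilter, Nat.card_Ioo]
    obtain ⟨k, rfl⟩ := Nat.exists_eq_add_of_lt hj
    rw [show j + k + 1 - j - 1 = k by omega, show j + k + 1 + j + 1 = k + 2 * (j + 1) by ring,
      pow_add, pow_mul]
    simp
  rw [← hsign, ← prod_mul_distrib]
  refine prod_nonneg fun i hi => ?_
  obtain ⟨hij, hi⟩ := mem_erase.mp hi
  have hi := mem_range.mp hi
  split_ifs with h
  · have := hz hj hi h
    have h' : (z j - z i)⁻¹ < 0 := inv_lt_zero.mpr (by linarith)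
    linarith
  · have := hz hi hj (by omega : i < j)
    have h' : 0 < (z j - z i)⁻¹ := inv_pos.mpr (by linarith)
    linarith

/-- A polynomial of degree at most `d` whose values alternate in sign along `d` nonnegative nodes,
ending with a nonnegative coefficient of `X ^ d`, has coefficients of alternating sign. -/
theorem neg_one_pow_mul_coeff_nonneg_of_alternating {d : ℕ} {z : ℕ → ℝ}
    (hz : StrictMonoOn z (Set.Iio d)) (hz0 : ∀ j < d, 0 ≤ z j) {P : Polynomial ℝ}
    (hP : P.natDegree ≤ d) (hPz : ∀ j < d, 0 ≤ (-1 : ℝ) ^ (d + j) * P.eval (z j))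
    (hPd : 0 ≤ P.coeff d) (m : ℕ) : 0 ≤ (-1 : ℝ) ^ (d + m) * P.coeff m := by
  set W : Polynomial ℝ := ∏ i ∈ range d, (Polynomial.X - Polynomial.C (z i)) with hW
  have hWmonic : W.Monic := Polynomial.monic_prod_X_sub_C _ _
  have hWdeg : W.natDegree = d := by
    rw [hW, Polynomial.natDegree_prod_of_monic _ _ fun i _ => Polynomial.monic_X_sub_C _]
    simp
  have hinj : Set.InjOn z (range d : Set ℕ) := by
    simpa using hz.injOn
  have hRdeg : (P - Polynomial.C (P.coeff d) * W).degree < #(range d) := by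
    rw [card_range, Polynomial.degree_lt_iff_coeff_zero]
    intro k hk
    rcases hk.eq_or_lt with rfl | hk
    · have : W.coeff d = 1 := by simpa [hWdeg] using hWmonic.coeff_natDegree
      simp [this]
    · simp [Polynomial.coeff_eq_zero_of_natDegree_lt (hP.trans_lt hk),
        Polynomial.coeff_eq_zero_of_natDegree_lt (hWdeg.trans_lt hk)]
  have hR := Lagrange.eq_interpolate_of_eval_eq (fun j => P.eval (z j)) hinj hRdeg
    (by
      intro j hj
      have : W.eval (z j) = 0 := by
        rw [hW, Polynomial.eval_prod]
        exact prod_eq_zero hj (by simp)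
      simp [this])
  have hcoeff : P.coeff m = P.coeff d * W.coeff m + ∑ j ∈ range d, P.eval (z j) *
      ((∏ i ∈ (range d).erase j, (z j - z i)⁻¹) *
        (∏ i ∈ (range d).erase j, (Polynomial.X - Polynomial.C (z i))).coeff m) := by
    have h := congrArg (fun p => Polynomial.coeff p m) hR
    simp only [Lagrange.interpolate_apply, Lagrange.basis, Lagrange.basisDivisor,
      prod_mul_distrib, ← map_prod, Polynomial.finsetSum_coeff, Polynomial.coeff_sub,
      Polynomial.coeff_C_mul] at h
    linarith
  rw [hcoeff, mul_add, mul_sum]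
  refine add_nonneg ?_ (sum_nonneg fun j hj => ?_)
  · have h := neg_one_pow_mul_coeff_prod_X_sub_C_nonneg (range d) z
      (fun i hi => hz0 i (mem_range.mp hi)) m
    rw [card_range] at h
    convert mul_nonneg hPd h using 1
    ring
  · have h := neg_one_pow_mul_coeff_prod_X_sub_C_nonneg ((range d).erase j) z
      (fun i hi => hz0 i (mem_range.mp (mem_of_mem_erase hi))) m
    have hj' := mem_range.mp hj
    rw [card_erase_of_mem hj, card_range] at h
    have h' := mul_nonneg (mul_nonneg (hPz j hj') (neg_one_pow_mul_prod_inv_sub_nonneg hz hj')) h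
    obtain ⟨k, rfl⟩ : ∃ k, d = k + 1 := ⟨d - 1, by omega⟩
    refine h'.trans_eq ?_
    rw [Nat.add_sub_cancel]
    have hsq : (-1 : ℝ) ^ (k + 1 + j) * (-1) ^ (k + 1 + j + 1) * (-1) ^ (k + m)
        = (-1) ^ (k + 1 + m) := by
      rw [← pow_add, ← pow_add, show k + 1 + j + (k + 1 + j + 1) + (k + m)
        = 2 * (k + 1 + j) + (k + 1 + m) by ring, pow_add _ (2 * _), pow_mul]
      simp
    rw [← hsq]
    ring

theorem sum_range_two_mul_add_one {M : Type*} [AddCommMonoid M] (f : ℕ → M) (d : ℕ) :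
    ∑ l ∈ range (2 * d + 1), f l
      = ∑ k ∈ range (d + 1), f (2 * k) + ∑ k ∈ range d, f (2 * k + 1) := by
  induction d with
  | zero => simp
  | succ d ih =>
    rw [show 2 * (d + 1) + 1 = 2 * d + 1 + 1 + 1 by ring, sum_range_succ, sum_range_succ, ih,
      sum_range_succ (fun k => f (2 * k)) (d + 1),
      sum_range_succ (fun k => f (2 * k + 1)) d, show 2 * (d + 1) = 2 * d + 1 + 1 by ring]
    abel

theorem re_one_add_mul_I_pow_two_mul (t : ℝ) (d : ℕ) :
    ((1 + t * Complex.I) ^ (2 * d)).re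
      = ∑ k ∈ range (d + 1), (-1 : ℝ) ^ k * ((2 * d).choose (2 * k) : ℝ) * (t ^ 2) ^ k := by
  have heven (k : ℕ) : ((t : ℂ) * Complex.I) ^ (2 * k) = (((-1 : ℝ) ^ k * (t ^ 2) ^ k : ℝ) : ℂ) := by
    rw [pow_mul, mul_pow, Complex.I_sq, mul_pow]
    push_cast
    ring
  rw [add_comm, add_pow, sum_range_two_mul_add_one, Complex.add_re, Complex.re_sum,
    Complex.re_sum, add_eq_left.mpr]
  · refine sum_congr rfl fun k _ => ?_
    rw [heven, one_pow, mul_one, ← Complex.ofReal_natCast, ← Complex.ofReal_mul,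
      Complex.ofReal_re]
    ring
  · refine sum_eq_zero fun k _ => ?_
    rw [pow_succ, heven, one_pow, mul_one, ← Complex.ofReal_natCast, Complex.re_mul_ofReal,
      Complex.re_ofReal_mul, Complex.re_ofReal_mul, Complex.I_re]
    simp

/-- The coefficients, up to the alternating sign, of the Chebyshev polynomial of degree `d` after
the change of variable `tan² φ` for `cos (2 φ)`. -/
theorem sum_choose_mul_tan_sq_pow {d j : ℕ} (hj : j < d) :
    ∑ k ∈ range (d + 1), (-1 : ℝ) ^ k * ((2 * d).choose (2 * k) : ℝ)
        * (Real.tan (j * Real.pi / (2 * d)) ^ 2) ^ k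
      = (-1) ^ j * (1 + Real.tan (j * Real.pi / (2 * d)) ^ 2) ^ d := by
  set φ : ℝ := j * Real.pi / (2 * d) with hφ
  have hd : (0 : ℝ) < d := by exact_mod_cast (Nat.zero_le j).trans_lt hj
  have hjd : (j : ℝ) < d := by exact_mod_cast hj
  have hcos : 0 < Real.cos φ := by
    refine Real.cos_pos_of_mem_Ioo ⟨?_, ?_⟩
    · have : 0 ≤ φ := by positivity
      linarith [Real.pi_pos]
    · rw [hφ, div_lt_div_iff₀ (by positivity) two_pos]
      nlinarith [Real.pi_pos]
  have hpow : (1 + (Real.tan φ : ℂ) * Complex.I) ^ (2 * d)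
      = (((-1) ^ j * (1 + Real.tan φ ^ 2) ^ d : ℝ) : ℂ) := by
    have hcosC : (Real.cos φ : ℂ) ≠ 0 := by exact_mod_cast hcos.ne'
    have hexp : (1 + (Real.tan φ : ℂ) * Complex.I) * Real.cos φ = Complex.exp (φ * Complex.I) := by
      rw [Complex.exp_mul_I, Real.tan_eq_sin_div_cos]
      push_cast at hcosC ⊢
      field_simp
    have hsq : (1 + Real.tan φ ^ 2) * Real.cos φ ^ 2 = 1 := by
      rw [Real.tan_eq_sin_div_cos]
      field_simp
      linarith [Real.sin_sq_add_cos_sq φ]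
    apply mul_right_cancel₀ (pow_ne_zero (2 * d) hcosC)
    rw [← mul_pow, hexp, ← Complex.exp_nat_mul,
      show ((2 * d : ℕ) : ℂ) * (φ * Complex.I) = (j : ℂ) * (Real.pi * Complex.I) by
        have hdC : (d : ℂ) ≠ 0 := by exact_mod_cast hd.ne'
        rw [hφ]
        push_cast
        field_simp,
      Complex.exp_nat_mul, Complex.exp_pi_mul_I, ← Complex.ofReal_pow, ← Complex.ofReal_mul,
      pow_mul (Real.cos φ), mul_assoc, ← mul_pow, hsq]
    simp
  rw [← re_one_add_mul_I_pow_two_mul, hpow, Complex.ofReal_re]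

theorem strictMonoOn_tan_sq_nodes (d : ℕ) :
    StrictMonoOn (fun j : ℕ => Real.tan (j * Real.pi / (2 * d)) ^ 2) (Set.Iio d) := by
  intro i hi j hj hij
  have hd : (0 : ℝ) < d := by exact_mod_cast (Nat.zero_le j).trans_lt hj
  have hjd : (j : ℝ) < d := by exact_mod_cast hj
  have hij' : (i : ℝ) < j := by exact_mod_cast hij
  have hlt : (i : ℝ) * Real.pi / (2 * d) < j * Real.pi / (2 * d) := by
    have := Real.pi_pos
    gcongr
  have hlt' : (j : ℝ) * Real.pi / (2 * d) < Real.pi / 2 := by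
    rw [div_lt_div_iff₀ (by positivity) two_pos]
    nlinarith [Real.pi_pos]
  have h0 : 0 ≤ (i : ℝ) * Real.pi / (2 * d) := by positivity
  exact pow_lt_pow_left₀ (Real.tan_lt_tan_of_nonneg_of_lt_pi_div_two h0 hlt' hlt)
    (Real.tan_nonneg_of_nonneg_of_le_pi_div_two h0 (hlt.trans hlt').le) two_ne_zero

/-- Extremality of the Chebyshev polynomial for coefficients in the Bernstein basis, in the
coordinate `z ≥ 0` of the projective line. -/
theorem abs_coeff_le_choose_mul_of_abs_eval_le {d : ℕ} {N : Polynomial ℝ} (hN : N.natDegree ≤ d)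
    {M : ℝ} (hNz : ∀ z : ℝ, 0 ≤ z → |N.eval z| ≤ M * (1 + z) ^ d) (hNd : |N.coeff d| ≤ M)
    {m : ℕ} (hm : m ≤ d) : |N.coeff m| ≤ M * (2 * d).choose (2 * m) := by
  set E : Polynomial ℝ := ∑ k ∈ range (d + 1),
    Polynomial.monomial k ((-1 : ℝ) ^ (d + k) * (2 * d).choose (2 * k)) with hE
  have hEcoeff (k : ℕ) (hk : k ≤ d) :
      E.coeff k = (-1 : ℝ) ^ (d + k) * (2 * d).choose (2 * k) := by
    simp [hE, Polynomial.coeff_monomial, Nat.lt_succ_of_le hk]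
  have hEdeg : E.natDegree ≤ d := Polynomial.natDegree_sum_le_of_forall_le _ _ fun k hk =>
    (Polynomial.natDegree_monomial_le _).trans (Nat.lt_succ_iff.mp (mem_range.mp hk))
  have hEeval (j : ℕ) (hj : j < d) : E.eval (Real.tan (j * Real.pi / (2 * d)) ^ 2)
      = (-1) ^ (d + j) * (1 + Real.tan (j * Real.pi / (2 * d)) ^ 2) ^ d := by
    rw [pow_add, mul_assoc, ← sum_choose_mul_tan_sq_pow hj, hE, Polynomial.eval_finsetSum, mul_sum]
    refine sum_congr rfl fun k _ => ?_
    rw [Polynomial.eval_monomial, pow_add]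
    ring
  have hsq (k : ℕ) : (-1 : ℝ) ^ (d + k) * (-1) ^ (d + k) = 1 := by
    rw [← mul_pow]
    simp
  have key (ε : ℝ) (hε : |ε| = 1) : 0 ≤ M * (2 * d).choose (2 * m)
      + (-1 : ℝ) ^ (d + m) * ε * N.coeff m := by
    have h := neg_one_pow_mul_coeff_nonneg_of_alternating (P := Polynomial.C M * E
      + Polynomial.C ε * N) (strictMonoOn_tan_sq_nodes d) (fun j _ => sq_nonneg _)
      (Polynomial.natDegree_add_le_of_degree_le
        ((Polynomial.natDegree_C_mul_le _ _).trans hEdeg)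
        ((Polynomial.natDegree_C_mul_le _ _).trans hN)) ?_ ?_ m
    · rw [Polynomial.coeff_add, Polynomial.coeff_C_mul, Polynomial.coeff_C_mul, hEcoeff m hm] at h
      linear_combination h + M * (2 * d).choose (2 * m) * hsq m
    · intro j hj
      have hle := hNz _ (sq_nonneg (Real.tan (j * Real.pi / (2 * d))))
      rw [Polynomial.eval_add, Polynomial.eval_C_mul, Polynomial.eval_C_mul, hEeval j hj]
      set w := Polynomial.eval (Real.tan (j * Real.pi / (2 * d)) ^ 2) N
      have habs : |(-1 : ℝ) ^ (d + j) * ε * w| = |w| := by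
        simp [abs_mul, hε]
      have := neg_abs_le ((-1 : ℝ) ^ (d + j) * ε * w)
      rw [habs] at this
      linear_combination this + hle - M * (1 + Real.tan (j * Real.pi / (2 * d)) ^ 2) ^ d * hsq j
    · rw [Polynomial.coeff_add, Polynomial.coeff_C_mul, Polynomial.coeff_C_mul, hEcoeff d le_rfl]
      have habs : |ε * N.coeff d| = |N.coeff d| := by rw [abs_mul, hε, one_mul]
      have := neg_abs_le (ε * N.coeff d)
      rw [habs] at this
      simp only [← two_mul, pow_mul, neg_one_sq, one_pow, Nat.choose_self, Nat.cast_one,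
        mul_one]
      linarith
  have habs : |(-1 : ℝ) ^ (d + m) * N.coeff m| = |N.coeff m| := by simp [abs_mul]
  rw [← habs, abs_le]
  constructor
  · linarith [key 1 (by simp)]
  · linarith [key (-1) (by simp)]

theorem choose_two_mul_two_mul_succ (d m : ℕ) (hm : m < d) :
    ((2 * d).choose (2 * (m + 1)) : ℝ) * ((m + 1) * (2 * m + 1))
      = (2 * d).choose (2 * m) * ((d - m) * (2 * d - 2 * m - 1)) := by
  have h1 := Nat.choose_succ_right_eq (2 * d) (2 * m)
  have h2 := Nat.choose_succ_right_eq (2 * d) (2 * m + 1)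
  obtain ⟨k, rfl⟩ := Nat.exists_eq_add_of_lt hm
  rw [show 2 * (m + k + 1) - 2 * m = 2 * k + 2 by omega] at h1
  rw [show 2 * (m + k + 1) - (2 * m + 1) = 2 * k + 1 by omega] at h2
  have h1' := congrArg (Nat.cast : ℕ → ℝ) h1
  have h2' := congrArg (Nat.cast : ℕ → ℝ) h2
  push_cast at h1' h2' ⊢
  rw [show 2 * (m + 1) = 2 * m + 1 + 1 by ring]
  linear_combination (2 * (m : ℝ) + 1) / 2 * h2' + (2 * (k : ℝ) + 1) / 2 * h1'

theorem choose_two_mul_two_mul_le (d m : ℕ) (hm : m ≤ d) :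
    ((2 * d).choose (2 * m) : ℝ) ≤ 2 * (d : ℝ) ^ m * d.choose m := by
  induction m with
  | zero => simp
  | succ m ih =>
    have hdm : (m : ℝ) + 1 ≤ d := by exact_mod_cast hm
    have h1 := choose_two_mul_two_mul_succ d m hm
    have h2 : (d.choose (m + 1) : ℝ) * (m + 1) = d.choose m * (d - m) := by
      have := congrArg (Nat.cast : ℕ → ℝ) (Nat.choose_succ_right_eq d m)
      push_cast [Nat.cast_sub (Nat.le_of_succ_le hm)] at this
      exact this
    have hm0 : (0 : ℝ) ≤ m := Nat.cast_nonneg m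
    refine le_of_mul_le_mul_right ?_ (by positivity : (0 : ℝ) < (m + 1) * (2 * m + 1))
    rw [h1, show 2 * (d : ℝ) ^ (m + 1) * d.choose (m + 1) * ((m + 1) * (2 * m + 1))
      = 2 * (d : ℝ) ^ (m + 1) * (2 * m + 1) * (d.choose (m + 1) * (m + 1)) by ring, h2]
    rcases m.eq_zero_or_pos with rfl | hmpos
    · norm_num
      nlinarith
    · have hm1 : (1 : ℝ) ≤ m := by exact_mod_cast hmpos
      have ih := ih (Nat.le_of_succ_le hm)
      calc ((2 * d).choose (2 * m) : ℝ) * ((d - m) * (2 * d - 2 * m - 1))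
          ≤ (2 * (d : ℝ) ^ m * d.choose m) * ((d - m) * (d * (2 * m + 1))) := by
            gcongr
            · exact mul_nonneg (by linarith) (by linarith)
            · linarith
            · nlinarith
        _ = _ := by ring

theorem eq_of_card_eq_of_symmetric {d : ℕ} {V : Type*} {L : (Fin d → V) → ℝ}
    (hsymm : ∀ (σ : Equiv.Perm (Fin d)) (v : Fin d → V), L (v ∘ σ) = L v) (x y : V)
    {S T : Finset (Fin d)} (h : #S = #T) :
    L (fun i => if i ∈ S then x else y) = L (fun i => if i ∈ T then x else y) := by
  have e : {i // i ∈ S} ≃ {i // i ∈ T} := Finset.equivOfCardEq h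
  rw [← hsymm e.extendSubtype (fun i => if i ∈ T then x else y)]
  congr 1
  funext i
  by_cases hi : i ∈ S
  · simp [hi, e.extendSubtype_mem i hi]
  · simp [hi, e.extendSubtype_not_mem i hi]

theorem eq_sum_powerset_of_affine {d : ℕ} {V : Type*} [AddCommGroup V] [Module ℝ V]
    {L : (Fin d → V) → ℝ}
    (haffine : ∀ (j : Fin d) (v : Fin d → V) (x y : V) (a : ℝ),
      L (Function.update v j (a • x + (1 - a) • y))
        = a * L (Function.update v j x) + (1 - a) * L (Function.update v j y))
    (x y : V) (a : ℝ) (T : Finset (Fin d)) (v : Fin d → V) :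
    L (fun i => if i ∈ T then a • x + (1 - a) • y else v i)
      = ∑ S ∈ T.powerset, a ^ #S * (1 - a) ^ (#T - #S) *
          L (fun i => if i ∈ S then x else if i ∈ T then y else v i) := by
  induction T using Finset.induction_on generalizing v with
  | empty => simp
  | insert j T hj ih =>
    have hupd (u : V) : (fun i => if i ∈ T then a • x + (1 - a) • y else Function.update v j u i)
        = Function.update (fun i => if i ∈ T then a • x + (1 - a) • y else v i) j u := by
      funext i
      by_cases hij : i = j
      · subst hij; simp [hj]
      · simp [hij]
    have hins : (fun i => if i ∈ insert j T then a • x + (1 - a) • y else v i)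
        = Function.update (fun i => if i ∈ T then a • x + (1 - a) • y else v i) j
          (a • x + (1 - a) • y) := by
      funext i
      by_cases hij : i = j
      · subst hij; simp
      · simp [hij]
    rw [hins, haffine, ← hupd, ← hupd, ih, ih, sum_powerset_insert hj, add_comm, mul_sum, mul_sum]
    congr 1
    · refine sum_congr rfl fun S hS => ?_
      have hST := mem_powerset.mp hS
      have hfun : (fun i => if i ∈ S then x else if i ∈ T then y else Function.update v j y i)
          = fun i => if i ∈ S then x else if i ∈ insert j T then y else v i := by
        funext i
        by_cases hij : i = j
        · subst hij; simp [hj]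
        · simp [hij]
      rw [hfun, card_insert_of_notMem hj, Nat.succ_sub (card_le_card hST), pow_succ]
      ring
    · refine sum_congr rfl fun S hS => ?_
      have hST := mem_powerset.mp hS
      have hjS : j ∉ S := fun h => hj (hST h)
      have hfun : (fun i => if i ∈ S then x else if i ∈ T then y else Function.update v j x i)
          = fun i => if i ∈ insert j S then x else if i ∈ insert j T then y else v i := by
        funext i
        by_cases hij : i = j
        · subst hij; simp [hj, hjS]
        · simp [hij]
      rw [hfun, card_insert_of_notMem hj, card_insert_of_notMem hjS, Nat.add_sub_add_right,
        pow_succ]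
      ring

/-- The Bernstein form of the restriction to a line of the diagonal of a symmetric `d`-affine
form. -/
theorem diag_eq_sum_range_of_affine_of_symmetric {d : ℕ} {V : Type*} [AddCommGroup V] [Module ℝ V]
    {L : (Fin d → V) → ℝ}
    (haffine : ∀ (j : Fin d) (v : Fin d → V) (x y : V) (a : ℝ),
      L (Function.update v j (a • x + (1 - a) • y))
        = a * L (Function.update v j x) + (1 - a) * L (Function.update v j y))
    (hsymm : ∀ (σ : Equiv.Perm (Fin d)) (v : Fin d → V), L (v ∘ σ) = L v)
    (x y : V) (a : ℝ) :
    L (fun _ => a • x + (1 - a) • y) = ∑ k ∈ range (d + 1), (d.choose k : ℝ) *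
      (a ^ k * (1 - a) ^ (d - k) * L (fun i => if (i : ℕ) < k then x else y)) := by
  have h := eq_sum_powerset_of_affine haffine x y a univ fun _ => y
  simp only [mem_univ, if_true, card_univ, Fintype.card_fin] at h
  rw [h]
  have hsum := sum_powerset_apply_card (x := (univ : Finset (Fin d)))
    (fun k => a ^ k * (1 - a) ^ (d - k) * L (fun i => if (i : ℕ) < k then x else y))
  rw [card_univ, Fintype.card_fin] at hsum
  simp only [nsmul_eq_mul] at hsum
  rw [← hsum]
  refine sum_congr rfl fun S _ => ?_
  have hcard : #S = #(univ.filter fun i : Fin d => (i : ℕ) < #S) := by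
    have hle : #S ≤ d := by simpa using card_le_univ S
    rw [Fin.card_filter_val_lt]
    omega
  rw [eq_of_card_eq_of_symmetric hsymm x y hcard]
  simp

theorem abs_eval_le_supOnBox {n : ℕ} (P : MvPolynomial (Fin n) ℝ) {x : Fin n → ℝ}
    (hx : ∀ i, x i ∈ Set.Icc (-1 : ℝ) 1) : |MvPolynomial.eval x P| ≤ supOnBox P := by
  have hcompact : IsCompact (Set.univ.pi fun _ : Fin n => Set.Icc (-1 : ℝ) 1) :=
    isCompact_univ_pi fun _ => isCompact_Icc
  have hbdd := (hcompact.image (MvPolynomial.continuous_eval P).abs).bddAbove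
  refine le_csSup (hbdd.mono ?_) ⟨x, hx, rfl⟩
  rintro _ ⟨z, hz, rfl⟩
  exact ⟨z, fun i _ => hz i, rfl⟩

/-- Polarization estimate for `d`-affine forms: if `L` is symmetric, affine in each of its `d`
vector variables, and agrees with the degree-`d` polynomial `Q` on the diagonal, then for each
`0 ≤ m ≤ d/2` and `x, y ∈ [-1,1]^n`, `|L(x,…,x,y,…,y)| ≤ 2 d^m ‖Q‖_{[-1,1]^n}`
(`x` appearing `m` times and `y` appearing `d - m` times). -/
theorem polarization_affine {n d : ℕ} (Q : MvPolynomial (Fin n) ℝ) (hQ : Q.totalDegree ≤ d)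
    (L : (Fin d → (Fin n → ℝ)) → ℝ)
    (haffine : ∀ (j : Fin d) (v : Fin d → (Fin n → ℝ)) (x y : Fin n → ℝ) (a : ℝ),
      L (Function.update v j (a • x + (1 - a) • y))
        = a * L (Function.update v j x) + (1 - a) * L (Function.update v j y))
    (hsymm : ∀ (σ : Equiv.Perm (Fin d)) (v : Fin d → (Fin n → ℝ)), L (v ∘ σ) = L v)
    (hdiag : ∀ x : Fin n → ℝ, L (fun _ => x) = MvPolynomial.eval x Q)
    (m : ℕ) (hm : 2 * m ≤ d)
    (x y : Fin n → ℝ) (hx : ∀ i, x i ∈ Set.Icc (-1 : ℝ) 1)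
    (hy : ∀ i, y i ∈ Set.Icc (-1 : ℝ) 1) :
    |L (fun i => if (i : ℕ) < m then x else y)| ≤ 2 * (d : ℝ) ^ m * supOnBox Q := by
  set b : ℕ → ℝ := fun k => L (fun i => if (i : ℕ) < k then x else y) with hb
  set N : Polynomial ℝ := ∑ k ∈ range (d + 1), Polynomial.monomial k (d.choose k * b k) with hN
  have hNcoeff (k : ℕ) (hk : k ≤ d) : N.coeff k = d.choose k * b k := by
    simp [hN, Polynomial.coeff_monomial, Nat.lt_succ_of_le hk]
  have hNdeg : N.natDegree ≤ d := Polynomial.natDegree_sum_le_of_forall_le _ _ fun k hk =>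
    (Polynomial.natDegree_monomial_le _).trans (Nat.lt_succ_iff.mp (mem_range.mp hk))
  have hNeval (z : ℝ) (hz : 0 ≤ z) : |N.eval z| ≤ supOnBox Q * (1 + z) ^ d := by
    set a : ℝ := z / (1 + z) with ha
    have hz1 : 0 < 1 + z := by linarith
    have ha0 : 0 ≤ a := by positivity
    have ha1 : 1 - a = 1 / (1 + z) := by
      rw [ha]
      field_simp
      ring
    have ha1' : 0 ≤ 1 - a := by rw [ha1]; positivity
    have hbox : ∀ i, (a • x + (1 - a) • y) i ∈ Set.Icc (-1 : ℝ) 1 := fun i =>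
      convex_Icc (-1 : ℝ) 1 (hx i) (hy i) ha0 ha1' (by ring)
    have heq : N.eval z = MvPolynomial.eval (a • x + (1 - a) • y) Q * (1 + z) ^ d := by
      rw [← hdiag, diag_eq_sum_range_of_affine_of_symmetric haffine hsymm, hN,
        Polynomial.eval_finsetSum, sum_mul]
      refine sum_congr rfl fun k hk => ?_
      obtain ⟨l, rfl⟩ := Nat.exists_eq_add_of_le (Nat.lt_succ_iff.mp (mem_range.mp hk))
      rw [Polynomial.eval_monomial, ha1, ha, Nat.add_sub_cancel_left,
        show L (fun i => if (i : ℕ) < k then x else y) = b k from rfl, div_pow, div_pow, pow_add]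
      field_simp
      ring
    rw [heq, abs_mul, abs_of_pos (pow_pos hz1 d)]
    gcongr
    exact abs_eval_le_supOnBox Q hbox
  have hNtop : |N.coeff d| ≤ supOnBox Q := by
    have hbd : b d = MvPolynomial.eval x Q := by
      rw [hb, ← hdiag x]
      simp
    rw [hNcoeff d le_rfl, Nat.choose_self, Nat.cast_one, one_mul, hbd]
    exact abs_eval_le_supOnBox Q hx
  have hmd : m ≤ d := by omega
  have hM : 0 ≤ supOnBox Q := (abs_nonneg _).trans hNtop
  have hpos : (0 : ℝ) < d.choose m := by exact_mod_cast Nat.choose_pos hmd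
  have h := abs_coeff_le_choose_mul_of_abs_eval_le hNdeg hNeval hNtop hmd
  rw [hNcoeff m hmd, abs_mul, abs_of_pos hpos] at h
  refine le_of_mul_le_mul_left (h.trans ?_) hpos
  calc supOnBox Q * ((2 * d).choose (2 * m) : ℝ)
      ≤ supOnBox Q * (2 * (d : ℝ) ^ m * d.choose m) := by
        gcongr
        exact choose_two_mul_two_mul_le d m hmd
    _ = _ := by ring
end

section
/- Let d ∈ ℕ and let Q be a real polynomial of degree at most d in one variable. Then there exist unique real numbers a₀, …, a_d such that Q(t) = ∑_{n=0}^d a_n ψ_{d,n}(t) for all t ∈ ℝ, and these coefficients satisfy |a_n| ≤ (∑_{m=0}^{min(d−n,n)} 4^m · binom(d,2m) · binom(d−2m, n−m)) · sup_{t ∈ [-1,1]} |Q(t)| for each 0 ≤ n ≤ d. -/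
open Finset Polynomial

/-- The polynomial `ψ_{d,m}(t) = ((1+t)/2)^m ((1-t)/2)^{d-m}`. -/
noncomputable def psi (d m : ℕ) : Polynomial ℝ :=
  (Polynomial.C (2⁻¹ : ℝ) * (1 + Polynomial.X)) ^ m *
    (Polynomial.C (2⁻¹ : ℝ) * (1 - Polynomial.X)) ^ (d - m)

/-- The sup of `|Q(t)|` over `t ∈ [-1,1]` for a univariate real polynomial `Q`. -/
noncomputable def supIcc (Q : Polynomial ℝ) : ℝ :=
  sSup {y : ℝ | ∃ t ∈ Set.Icc (-1 : ℝ) 1, y = |Q.eval t|}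

/-- Every product of linear factors with roots in `[-1, 1]` has alternating `psi`-coefficients. -/
lemma exists_prod_X_sub_C_eq_sum_psi {ι : Type*} (s : Finset ι) (x : ι → ℝ)
    (hx : ∀ i ∈ s, x i ∈ Set.Icc (-1 : ℝ) 1) :
    ∃ c : ℕ → ℝ, (∀ n, 0 ≤ c n) ∧
      ∏ i ∈ s, (X - C (x i)) =
        ∑ n ∈ range (#s + 1), C ((-1) ^ (#s + n) * c n) * psi #s n := by
  classical
  induction s using Finset.induction_on with
  | empty => exact ⟨fun _ => 1, fun _ => zero_le_one, by simp [psi]⟩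
  | insert a s ha ih =>
    obtain ⟨c, hc, hprod⟩ := ih fun i hi => hx i (mem_insert_of_mem hi)
    obtain ⟨h1, h2⟩ := hx a (mem_insert_self a s)
    refine ⟨fun n => (if n ≤ #s then (1 + x a) * c n else 0) +
      (if n = 0 then 0 else (1 - x a) * c (n - 1)), fun n => ?_, ?_⟩
    · have := mul_nonneg (by linarith : 0 ≤ 1 + x a) (hc n)
      have := mul_nonneg (by linarith : 0 ≤ 1 - x a) (hc (n - 1))
      dsimp only
      split_ifs <;> linarith
    · have hlin : (X : ℝ[X]) - C (x a) = C (1 - x a) * (C 2⁻¹ * (1 + X)) -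
          C (1 + x a) * (C 2⁻¹ * (1 - X)) := by
        have h2 : (C (2⁻¹ : ℝ)) * 2 = 1 := by
          rw [show (2 : ℝ[X]) = C 2 from rfl, ← C_mul]; norm_num
        simp only [C_sub, C_add, C_1]
        linear_combination (C (x a) - X) * h2
      rw [prod_insert ha, hprod, card_insert_of_notMem ha, hlin, sub_mul, sub_eq_neg_add]
      simp_rw [mul_add ((-1 : ℝ) ^ _), C_add (a := (-1 : ℝ) ^ _ * _), add_mul _ _ (psi _ _)]
      rw [sum_add_distrib]
      congr 1
      · rw [sum_range_succ _ (#s + 1), if_neg (by omega), mul_zero, C_0, zero_mul, add_zero,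
          mul_sum, ← sum_neg_distrib]
        refine sum_congr rfl fun n hn => ?_
        have hn : n ≤ #s := by simpa [Nat.lt_succ_iff] using hn
        simp only [hn, if_true, psi, Nat.sub_add_comm hn]
        rw [show (-1 : ℝ) ^ (#s + 1 + n) = -(-1) ^ (#s + n) by ring]
        simp only [C_mul, C_neg, neg_mul]
        ring
      · rw [sum_range_succ' _ (#s + 1), if_pos rfl, mul_zero, C_0, zero_mul, add_zero, mul_sum]
        refine sum_congr rfl fun n hn => ?_
        simp only [psi, Nat.add_sub_add_right, Nat.add_eq_zero_iff, one_ne_zero, and_false,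
          if_false, Nat.add_sub_cancel]
        rw [show (-1 : ℝ) ^ (#s + 1 + (n + 1)) = (-1) ^ (#s + n) by ring]
        simp only [C_mul]
        ring

/-- The `psi`-coefficients of a polynomial of degree at most `d`, as combinations of its values at
the extremal points of the Chebyshev polynomial `T_d` with weights of known sign. -/
lemma exists_eq_sum_sumNodes_mul_psi (d : ℕ) :
    ∃ w : ℕ → ℕ → ℝ, (∀ n, ∀ j ≤ d, 0 ≤ (-1) ^ j * w n j) ∧
      ∀ Q : ℝ[X], Q.natDegree ≤ d → Q = ∑ n ∈ range (d + 1),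
        C ((-1) ^ (d + n) * Chebyshev.sumNodes d (w n) Q) * psi d n := by
  have hex (j : ℕ) := exists_prod_X_sub_C_eq_sum_psi ((range (d + 1)).erase j)
    (Chebyshev.node d) fun _ _ => Chebyshev.node_mem_Icc
  choose c hc hprod using hex
  let p (j : ℕ) := ∏ i ∈ (range (d + 1)).erase j, (Chebyshev.node d j - Chebyshev.node d i)
  refine ⟨fun n j => (p j)⁻¹ * c j n, fun n j hj => ?_, fun Q hQ => ?_⟩
  · have := inv_pos_of_pos <| Chebyshev.zero_lt_prod_node_sub_node hj
    rw [mul_inv, ← inv_pow, inv_neg_one] at this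
    rw [← mul_assoc]
    exact mul_nonneg this.le (hc j n)
  · have hdeg : Q.degree < #(range (d + 1)) := by
      rw [card_range]
      exact degree_le_natDegree.trans_lt (by exact_mod_cast Nat.lt_succ_of_le hQ)
    conv_lhs => rw [Lagrange.eq_interpolate (Chebyshev.strictAntiOn_node d).injOn hdeg,
      Lagrange.interpolate_apply]
    simp only [Chebyshev.sumNodes, mul_sum, map_sum, sum_mul]
    rw [sum_comm, ← Nat.range_succ_eq_Iic]
    refine sum_congr rfl fun j hj => ?_
    have hb : Lagrange.basis (range (d + 1)) (Chebyshev.node d) j =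
        C (p j)⁻¹ * ∏ i ∈ (range (d + 1)).erase j, (X - C (Chebyshev.node d i)) := by
      simp only [Lagrange.basis, Lagrange.basisDivisor, prod_mul_distrib, p, ← prod_inv_distrib,
        map_prod]
    have hcard : #((range (d + 1)).erase j) = d := by simp [card_erase_of_mem hj]
    rw [hb, hprod j, hcard, mul_sum, mul_sum]
    refine sum_congr rfl fun n _ => ?_
    simp only [C_mul]
    ring

lemma linearIndependent_psi (d : ℕ) :
    LinearIndependent ℝ fun n : Fin (d + 1) => psi d n := by
  obtain ⟨w, -, hw⟩ := exists_eq_sum_sumNodes_mul_psi d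
  rw [linearIndependent_iff_card_le_finrank_span, Set.finrank]
  have hle : degreeLT ℝ (d + 1) ≤
      Submodule.span ℝ (Set.range fun n : Fin (d + 1) => psi d n) := fun Q hQ => by
    have hQ : Q.natDegree ≤ d := natDegree_le_iff_degree_le.2 (by
      rwa [← mem_degreeLE, ← degreeLT_succ_eq_degreeLE])
    rw [hw Q hQ, sum_range]
    refine Submodule.sum_mem _ fun n _ => ?_
    rw [← smul_eq_C_mul]
    exact Submodule.smul_mem _ _ (Submodule.subset_span ⟨n, rfl⟩)
  have := FiniteDimensional.span_of_finite ℝ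
    (Set.finite_range fun n : Fin (d + 1) => psi d n)
  calc Fintype.card (Fin (d + 1)) = Module.finrank ℝ (degreeLT ℝ (d + 1)) := by
        rw [(degreeLTEquiv ℝ (d + 1)).finrank_eq, Module.finrank_fin_fun, Fintype.card_fin]
    _ ≤ _ := Submodule.finrank_mono hle

lemma eq_of_sum_psi_eq {d : ℕ} {a b : Fin (d + 1) → ℝ}
    (h : ∑ n, C (a n) * psi d n = ∑ n, C (b n) * psi d n) : a = b := by
  have := Fintype.linearIndependent_iff.1 (linearIndependent_psi d) (a - b) (by
    simp only [smul_eq_C_mul, Pi.sub_apply, C_sub, sub_mul, sum_sub_distrib, h, sub_self])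
  exact funext fun n => sub_eq_zero.1 (this n)

lemma sum_range_eq_sum_even {M : Type*} [AddCommMonoid M] (d : ℕ) (f : ℕ → M)
    (hf : ∀ m, Odd m → f m = 0) :
    ∑ m ∈ range (2 * d + 1), f m = ∑ n ∈ range (d + 1), f (2 * n) := by
  induction d with
  | zero => simp
  | succ d ih =>
    rw [sum_range_succ _ (d + 1), ← ih, show 2 * (d + 1) + 1 = 2 * d + 1 + 1 + 1 by ring,
      sum_range_succ, sum_range_succ _ (2 * d + 1), hf _ ⟨d, rfl⟩, add_zero]
    rfl

/-- The `psi`-coefficients of the Chebyshev polynomials are binomial coefficients up to sign. -/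
lemma chebyshev_T_eq_sum_psi (d : ℕ) :
    Chebyshev.T ℝ d =
      ∑ n ∈ range (d + 1), C ((-1) ^ (d + n) * ((2 * d).choose (2 * n) : ℝ)) * psi d n := by
  refine eq_of_infinite_eval_eq _ _ ((Set.Ici_infinite (1 : ℝ)).mono fun t ht => ?_)
  obtain ⟨y, hy⟩ : ∃ y, Real.cosh (2 * y) = t :=
    ⟨Real.arcosh t / 2, by rw [mul_div_cancel₀ _ two_ne_zero, Real.cosh_arcosh ht]⟩
  have hu : 2⁻¹ * (1 + t) = Real.cosh y ^ 2 := by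
    rw [← hy, Real.cosh_two_mul, Real.sinh_sq]; ring
  have hv : 2⁻¹ * (1 - t) = -Real.sinh y ^ 2 := by
    rw [← hy, Real.cosh_two_mul, Real.cosh_sq]; ring
  have hT : (Chebyshev.T ℝ d).eval t =
      ((Real.cosh y + Real.sinh y) ^ (2 * d) + (Real.cosh y + -Real.sinh y) ^ (2 * d)) / 2 := by
    rw [← hy, Chebyshev.T_real_cosh, ← sub_eq_add_neg, Real.cosh_add_sinh, Real.cosh_sub_sinh,
      ← Real.exp_nat_mul, ← Real.exp_nat_mul, Real.cosh_eq]
    push_cast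
    ring_nf
  rw [Set.mem_ofPred_eq, hT, add_pow, add_pow, ← sum_add_distrib, sum_div,
    sum_range_eq_sum_even _ _ fun m hm => ?_, eval_finsetSum]
  · refine sum_congr rfl fun n hn => ?_
    have hn : n ≤ d := by simpa [Nat.lt_succ_iff] using hn
    obtain ⟨k, rfl⟩ := Nat.exists_eq_add_of_le hn
    simp only [psi, eval_mul, eval_C, eval_pow, eval_add, eval_sub, eval_one, eval_X, hu, hv]
    rw [show 2 * (n + k) - 2 * n = 2 * k by omega, show n + k - n = k by omega,
      (even_two_mul k).neg_pow, neg_pow (Real.sinh y ^ 2),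
      show (-1 : ℝ) ^ (n + k + n) = (-1) ^ k * ((-1) ^ n * (-1) ^ n) by ring,
      ← mul_pow]
    have hk : (-1 : ℝ) ^ k * (-1) ^ k = 1 := by rw [← mul_pow]; norm_num
    norm_num
    linear_combination (-Real.cosh y ^ (2 * n) * Real.sinh y ^ (2 * k) *
      ((2 * (n + k)).choose (2 * n) : ℝ)) * hk
  · rcases le_or_gt m (2 * d) with h | h
    · rw [(Nat.Even.sub_odd h (even_two_mul d) hm).neg_pow]
      ring
    · simp [Nat.choose_eq_zero_of_lt h]

lemma choose_two_mul_two_mul_eq_sum {d n : ℕ} (hn : n ≤ d) :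
    (2 * d).choose (2 * n) = ∑ m ∈ range (min (d - n) n + 1),
      4 ^ m * d.choose (2 * m) * (d - 2 * m).choose (n - m) := by
  have hcoeff : (2 * d).choose (2 * n) =
      ∑ j ∈ range (d + 1), 2 ^ j * d.choose j *
        (((1 + X ^ 2 : ℕ[X]) ^ (d - j)) * X ^ j).coeff (2 * n) := by
    rw [← Nat.cast_id ((2 * d).choose _), ← coeff_one_add_X_pow ℕ, pow_mul, show (1 + X : ℕ[X]) ^ 2 = C 2 * X + (1 + X ^ 2) by
      rw [show (C 2 : ℕ[X]) = 2 from rfl]; ring, add_pow, finsetSum_coeff]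
    refine sum_congr rfl fun j _ => ?_
    rw [← coeff_C_mul]
    congr 1
    rw [← C_eq_natCast, Nat.cast_id, C_mul, C_pow, mul_pow]
    ring
  have hexp (e k : ℕ) : ((1 + X ^ 2 : ℕ[X]) ^ e).coeff k =
      if 2 ∣ k then e.choose (k / 2) else 0 := by
    rw [show (1 + X ^ 2 : ℕ[X]) ^ e = expand ℕ 2 ((1 + X) ^ e) by simp,
      coeff_expand two_pos, coeff_one_add_X_pow]
    rfl
  simp only [coeff_mul_X_pow', hexp] at hcoeff
  rw [hcoeff, sum_subset (range_subset_range.2 (by omega : d + 1 ≤ 2 * d + 1)) fun j _ hj => ?_,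
    sum_range_eq_sum_even _ _ fun j hj => ?_]
  · symm
    rw [← sum_subset (range_subset_range.2 (by omega : min (d - n) n + 1 ≤ d + 1))
      fun m _ hm => ?_]
    · refine sum_congr rfl fun m hm => ?_
      have hm : m ≤ min (d - n) n := by simpa [Nat.lt_succ_iff] using hm
      rw [if_pos (by omega), if_pos (by omega), ← Nat.mul_sub, Nat.mul_div_cancel_left _ two_pos,
        pow_mul]
      norm_num
    · have hm : min (d - n) n < m := by rw [mem_range] at hm; omega
      split_ifs
      · rw [← Nat.mul_sub, Nat.mul_div_cancel_left _ two_pos]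
        rcases le_or_gt (2 * m) d with h | h
        · rw [Nat.choose_eq_zero_of_lt (by omega : d - 2 * m < n - m), mul_zero]
        · rw [Nat.choose_eq_zero_of_lt h, mul_zero, zero_mul]
      all_goals simp
  · obtain ⟨k, rfl⟩ := hj
    split_ifs
    · omega
    all_goals simp
  · rw [Nat.choose_eq_zero_of_lt (by simpa using hj), mul_zero, zero_mul]

lemma abs_eval_le_supIcc (Q : ℝ[X]) {t : ℝ} (ht : t ∈ Set.Icc (-1 : ℝ) 1) :
    |Q.eval t| ≤ supIcc Q := by
  refine le_csSup ?_ ⟨t, ht, rfl⟩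
  obtain ⟨M, hM⟩ := isCompact_Icc.bddAbove_image (f := fun t : ℝ => |Q.eval t|)
    (K := Set.Icc (-1) 1) (by fun_prop)
  exact ⟨M, fun _ ⟨t, ht, h⟩ => h ▸ hM ⟨t, ht, rfl⟩⟩

lemma abs_sumNodes_le {d : ℕ} {w : ℕ → ℝ} (hw : ∀ j ≤ d, 0 ≤ (-1) ^ j * w j) (Q : ℝ[X]) :
    |Chebyshev.sumNodes d w Q| ≤ Chebyshev.sumNodes d w (Chebyshev.T ℝ d) * supIcc Q := by
  simp only [Chebyshev.sumNodes, sum_mul]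
  refine (abs_sum_le_sum_abs _ _).trans (sum_le_sum fun j hj => ?_)
  rw [Chebyshev.eval_T_real_node hj, ← abs_of_nonneg (hw j (mem_Iic.1 hj)), abs_mul, abs_mul,
    abs_neg_one_pow, one_mul, mul_comm]
  exact mul_le_mul_of_nonneg_left (abs_eval_le_supIcc Q Chebyshev.node_mem_Icc) (abs_nonneg _)

/-- Every real polynomial `Q` of degree at most `d` has a unique expansion
`Q = ∑_{n=0}^d a_n ψ_{d,n}` in the basis `ψ_{d,n}`, and its coefficients satisfy
`|a_n| ≤ (∑_{m=0}^{min(d-n,n)} 4^m C(d,2m) C(d-2m,n-m)) · sup_{t∈[-1,1]} |Q(t)|`. -/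
theorem psi_basis_markov_type (d : ℕ) (Q : Polynomial ℝ) (hQ : Q.natDegree ≤ d) :
    (∃! a : Fin (d + 1) → ℝ, Q = ∑ n : Fin (d + 1), Polynomial.C (a n) * psi d n) ∧
    ∀ a : Fin (d + 1) → ℝ, Q = ∑ n : Fin (d + 1), Polynomial.C (a n) * psi d n →
      ∀ n : Fin (d + 1),
        |a n| ≤ (∑ m ∈ Finset.range (min (d - (n : ℕ)) (n : ℕ) + 1),
            (4 : ℝ) ^ m * (d.choose (2 * m)) * ((d - 2 * m).choose ((n : ℕ) - m)))
          * supIcc Q := by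
  obtain ⟨w, hw, hrep⟩ := exists_eq_sum_sumNodes_mul_psi d
  have hrep' (P : ℝ[X]) (hP : P.natDegree ≤ d) :
      P = ∑ n : Fin (d + 1), C ((-1) ^ (d + (n : ℕ)) * Chebyshev.sumNodes d (w n) P) * psi d n :=
    (hrep P hP).trans (sum_range _)
  refine ⟨⟨_, hrep' Q hQ, fun b hb => eq_of_sum_psi_eq (hb.symm.trans (hrep' Q hQ))⟩,
    fun a ha n => ?_⟩
  have hT := congrFun (eq_of_sum_psi_eq <|
    (hrep' (Chebyshev.T ℝ d) (by simp)).symm.trans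
      ((chebyshev_T_eq_sum_psi d).trans (sum_range _))) n
  replace hT := mul_left_cancel₀ (pow_ne_zero _ (by norm_num)) hT
  rw [congrFun (eq_of_sum_psi_eq (ha.symm.trans (hrep' Q hQ))) n, abs_mul, abs_neg_one_pow, one_mul]
  refine (abs_sumNodes_le (hw n) Q).trans_eq ?_
  rw [hT, choose_two_mul_two_mul_eq_sum (Nat.lt_succ_iff.1 n.2)]
  push_cast
  rfl
end

section
/- For all integers d ≥ 1 and 0 ≤ m ≤ d/2, one has (1/binom(d,m)) · ∑_{k=0}^{m} 4^k · binom(d,2k) · binom(d−2k, m−k) ≤ 2 d^m. -/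
open Finset

theorem choose_two_mul_mul_centralBinom (k a b : ℕ) :
    (2 * k + a + b).choose (2 * k) * (a + b).choose a * k.centralBinom =
      (2 * k + a + b).choose (k + a) * (k + a).choose k * (k + b).choose k := by
  have key (i j : ℕ) : (i + j).choose i * i.factorial * j.factorial = (i + j).factorial := by
    rw [Nat.choose_symm_add, Nat.add_choose_mul_factorial_mul_factorial]
  have h₁ := key (2 * k) (a + b)
  have h₂ := key a b
  have h₃ := key k k
  have h₄ := key (k + a) (k + b)
  have h₅ := key k a
  have h₆ := key k b
  rw [← add_assoc] at h₁
  rw [show k + a + (k + b) = 2 * k + a + b by ring] at h₄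
  rw [← two_mul, ← Nat.centralBinom_eq_two_mul_choose] at h₃
  have hpos : 0 < k.factorial * k.factorial * a.factorial * b.factorial := by positivity
  refine Nat.eq_of_mul_eq_mul_right hpos ?_
  trans (2 * k + a + b).factorial
  · rw [← h₁, ← h₂, ← h₃]
    ring
  · rw [← h₄, ← h₅, ← h₆]
    ring

theorem four_pow_mul_choose_le (n k : ℕ) :
    4 ^ k * n.choose k ≤ 2 * n ^ k * k.centralBinom := by
  rcases Nat.eq_zero_or_pos k with rfl | hk
  · simp
  have h : k * n.choose k ≤ n ^ k :=
    calc k * n.choose k ≤ k.factorial * n.choose k :=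
          Nat.mul_le_mul_right _ k.self_le_factorial
      _ = n.descFactorial k := (Nat.descFactorial_eq_factorial_mul_choose n k).symm
      _ ≤ n ^ k := Nat.descFactorial_le_pow n k
  calc 4 ^ k * n.choose k ≤ 2 * k * k.centralBinom * n.choose k :=
        Nat.mul_le_mul_right _ (Nat.four_pow_le_two_mul_self_mul_centralBinom k hk)
    _ = 2 * (k * n.choose k) * k.centralBinom := by ring
    _ ≤ 2 * n ^ k * k.centralBinom := by gcongr

theorem four_pow_mul_choose_mul_choose_le {d m k : ℕ} (hk : k ≤ m) (hm : 2 * m ≤ d) :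
    4 ^ k * d.choose (2 * k) * (d - 2 * k).choose (m - k) ≤
      d.choose m * (2 * ((d - m) ^ k * m.choose k)) := by
  obtain ⟨a, rfl⟩ := Nat.exists_eq_add_of_le hk
  obtain ⟨b, rfl⟩ := Nat.exists_eq_add_of_le (show 2 * k + a ≤ d by omega)
  rw [show 2 * k + a + b - 2 * k = a + b by omega, show k + a - k = a by omega,
    show 2 * k + a + b - (k + a) = k + b by omega]
  refine Nat.le_of_mul_le_mul_right ?_ k.centralBinom_pos
  calc _ = 4 ^ k * ((2 * k + a + b).choose (2 * k) * (a + b).choose a * k.centralBinom) := by ring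
    _ = (2 * k + a + b).choose (k + a) * (k + a).choose k * (4 ^ k * (k + b).choose k) := by
        rw [choose_two_mul_mul_centralBinom]
        ring
    _ ≤ (2 * k + a + b).choose (k + a) * (k + a).choose k *
          (2 * (k + b) ^ k * k.centralBinom) :=
        Nat.mul_le_mul_left _ (four_pow_mul_choose_le _ _)
    _ = _ := by ring

theorem sum_four_pow_mul_choose_mul_choose_le {d m : ℕ} (hm : 2 * m ≤ d) :
    ∑ k ∈ Finset.range (m + 1), 4 ^ k * d.choose (2 * k) * (d - 2 * k).choose (m - k) ≤
      d.choose m * (2 * d ^ m) := by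
  calc _ ≤ ∑ k ∈ Finset.range (m + 1), d.choose m * (2 * ((d - m) ^ k * m.choose k)) :=
        Finset.sum_le_sum fun k hk ↦
          four_pow_mul_choose_mul_choose_le (Nat.lt_succ_iff.mp (Finset.mem_range.mp hk)) hm
    _ = d.choose m * (2 * (d - m + 1) ^ m) := by
        simp [add_pow, Finset.mul_sum]
    _ ≤ d.choose m * (2 * d ^ m) := by
        rcases Nat.eq_zero_or_pos m with rfl | hpos
        · simp
        · gcongr
          omega

/-- For `d ≥ 1` and `0 ≤ m ≤ d/2`,
`(1/C(d,m)) ∑_{k=0}^m 4^k C(d,2k) C(d−2k,m−k) ≤ 2 d^m`. -/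
theorem binomial_sum_le (d m : ℕ) (hd : 1 ≤ d) (hm : 2 * m ≤ d) :
    ((d.choose m : ℝ))⁻¹ *
        ∑ k ∈ Finset.range (m + 1),
          (4 : ℝ) ^ k * (d.choose (2 * k)) * ((d - 2 * k).choose (m - k))
      ≤ 2 * (d : ℝ) ^ m := by
  have hpos : (0 : ℝ) < d.choose m := by
    exact_mod_cast Nat.choose_pos (show m ≤ d by omega)
  rw [inv_mul_le_iff₀ hpos]
  exact_mod_cast sum_four_pow_mul_choose_mul_choose_le hm
end

section
/- There is a constant L ≥ 1 such that for every n, d ∈ ℕ and every function f : {-1,1}^n → ℝ of degree at most d, ∑_{k=1}^{D(n,d)} f*(k) · k^{-(d−1)/(2d)} ≤ L^d · ‖f‖_∞, where D(n,d) = ∑_{m=0}^{d} binom(n,m) and (f*(k))_{k=1}^{D(n,d)} is the decreasing rearrangement of the family (|f̂(S)|)_{S ⊆ [n], |S| ≤ d}. -/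
open Finset

/-- The Walsh character `χ_S(x) = ∏_{k ∈ S} x_k` on the Boolean cube `{-1,1}^n`,
where a point of the cube is encoded as `x : Fin n → Bool` (`true ↦ 1`, `false ↦ -1`). -/
noncomputable def walsh {n : ℕ} (S : Finset (Fin n)) (x : Fin n → Bool) : ℝ :=
  ∏ k ∈ S, (if x k then (1 : ℝ) else -1)

/-- The Fourier–Walsh coefficient `f̂(S) = 2^{-n} ∑_x f(x) χ_S(x)`. -/
noncomputable def walshCoeff {n : ℕ} (f : (Fin n → Bool) → ℝ) (S : Finset (Fin n)) : ℝ :=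
  (∑ x : Fin n → Bool, f x * walsh S x) / 2 ^ n

/-- The sup norm `‖f‖_∞ = max_x |f(x)|` on the Boolean cube. -/
noncomputable def supNorm {n : ℕ} (f : (Fin n → Bool) → ℝ) : ℝ :=
  ⨆ x : Fin n → Bool, |f x|

/-- The factor attached to a point of the cube by the coordinate `i`, as a real number. -/
noncomputable def cubeSign {n : ℕ} (i : Fin n) (x : Fin n → Bool) : ℝ := if x i then 1 else -1

/-- The Walsh polynomial with coefficients `c` and variables in `U`. -/
noncomputable def walshSum {n : ℕ} (U : Finset (Fin n)) (c : Finset (Fin n) → ℝ)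
    (x : Fin n → Bool) : ℝ :=
  ∑ S ∈ U.powerset, c S * walsh S x

section Cube

variable {n : ℕ}

lemma cubeSign_sq (i : Fin n) (x : Fin n → Bool) : cubeSign i x ^ 2 = 1 := by
  unfold cubeSign; split_ifs <;> norm_num

lemma abs_cubeSign (i : Fin n) (x : Fin n → Bool) : |cubeSign i x| = 1 := by
  unfold cubeSign; split_ifs <;> norm_num

lemma walsh_eq_prod_cubeSign (S : Finset (Fin n)) (x : Fin n → Bool) :
    walsh S x = ∏ i ∈ S, cubeSign i x := rfl

lemma abs_walsh (S : Finset (Fin n)) (x : Fin n → Bool) : |walsh S x| = 1 := by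
  rw [walsh_eq_prod_cubeSign, Finset.abs_prod]
  exact Finset.prod_eq_one fun i _ => abs_cubeSign i x

lemma walshSum_insert {U : Finset (Fin n)} {a : Fin n} (ha : a ∉ U) (c : Finset (Fin n) → ℝ)
    (x : Fin n → Bool) :
    walshSum (insert a U) c x
      = walshSum U c x + cubeSign a x * walshSum U (fun S => c (insert a S)) x := by
  unfold walshSum
  rw [Finset.sum_powerset_insert ha, Finset.mul_sum]
  congr 1
  refine Finset.sum_congr rfl fun S hS => ?_
  have haS : a ∉ S := fun h => ha (Finset.mem_powerset.mp hS h)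
  rw [walsh_eq_prod_cubeSign, Finset.prod_insert haS, ← walsh_eq_prod_cubeSign]
  ring

lemma walshSum_update {U : Finset (Fin n)} {a : Fin n} (ha : a ∉ U) (c : Finset (Fin n) → ℝ)
    (x : Fin n → Bool) (b : Bool) :
    walshSum U c (Function.update x a b) = walshSum U c x := by
  unfold walshSum
  refine Finset.sum_congr rfl fun S hS => ?_
  congr 1
  unfold walsh
  refine Finset.prod_congr rfl fun k hk => ?_
  have hka : k ≠ a := fun h => ha (Finset.mem_powerset.mp hS (h ▸ hk))
  rw [Function.update_of_ne hka]

lemma sum_cubeSign_mul_eq_zero (a : Fin n) (h : (Fin n → Bool) → ℝ)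
    (hh : ∀ (x : Fin n → Bool) (b : Bool), h (Function.update x a b) = h x) :
    ∑ x : Fin n → Bool, cubeSign a x * h x = 0 := by
  have hinv : Function.Involutive fun x : Fin n → Bool => Function.update x a (!x a) := by
    intro x
    simp
  have key := Equiv.sum_comp (hinv.toPerm _) fun x : Fin n → Bool => cubeSign a x * h x
  have hneg : ∀ x : Fin n → Bool, cubeSign a (Function.update x a (!x a))
      * h (Function.update x a (!x a)) = -(cubeSign a x * h x) := by
    intro x
    rw [hh]
    unfold cubeSign
    cases hx : x a <;> simp
  simp only [Function.Involutive.coe_toPerm, hneg, Finset.sum_neg_distrib] at key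
  linarith

lemma sum_walshSum_insert_sq {U : Finset (Fin n)} {a : Fin n} (ha : a ∉ U)
    (c : Finset (Fin n) → ℝ) :
    ∑ x, walshSum (insert a U) c x ^ 2
      = ∑ x, walshSum U c x ^ 2 + ∑ x, walshSum U (fun S => c (insert a S)) x ^ 2 := by
  have h0 := sum_cubeSign_mul_eq_zero a
    (fun x => 2 * walshSum U c x * walshSum U (fun S => c (insert a S)) x)
    (fun x b => by simp only [walshSum_update ha])
  rw [← Finset.sum_add_distrib, ← add_zero (∑ x, (_ + _)), ← h0, ← Finset.sum_add_distrib]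
  refine Finset.sum_congr rfl fun x _ => ?_
  rw [walshSum_insert ha]
  linear_combination walshSum U (fun S => c (insert a S)) x ^ 2 * cubeSign_sq a x

lemma sum_walshSum_insert_pow_four {U : Finset (Fin n)} {a : Fin n} (ha : a ∉ U)
    (c : Finset (Fin n) → ℝ) :
    ∑ x, walshSum (insert a U) c x ^ 4
      = ∑ x, walshSum U c x ^ 4
        + 6 * ∑ x, walshSum U c x ^ 2 * walshSum U (fun S => c (insert a S)) x ^ 2
        + ∑ x, walshSum U (fun S => c (insert a S)) x ^ 4 := by
  have h0 := sum_cubeSign_mul_eq_zero a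
    (fun x => 4 * walshSum U c x ^ 3 * walshSum U (fun S => c (insert a S)) x
      + 4 * walshSum U c x * walshSum U (fun S => c (insert a S)) x ^ 3)
    (fun x b => by simp only [walshSum_update ha])
  rw [Finset.mul_sum, ← Finset.sum_add_distrib, ← Finset.sum_add_distrib,
    ← add_zero (∑ x, (_ + _)), ← h0, ← Finset.sum_add_distrib]
  refine Finset.sum_congr rfl fun x _ => ?_
  rw [walshSum_insert ha]
  set p := walshSum U c x
  set q := walshSum U (fun S => c (insert a S)) x
  linear_combination (6 * p ^ 2 * q ^ 2 + 4 * p * q ^ 3 * cubeSign a x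
    + q ^ 4 * (cubeSign a x ^ 2 + 1)) * cubeSign_sq a x

/-- Parseval's identity. -/
lemma sum_walshSum_sq (U : Finset (Fin n)) (c : Finset (Fin n) → ℝ) :
    ∑ x, walshSum U c x ^ 2 = 2 ^ n * ∑ S ∈ U.powerset, c S ^ 2 := by
  induction U using Finset.induction_on generalizing c with
  | empty => simp [walshSum, walsh]
  | insert a U ha ih =>
    rw [sum_walshSum_insert_sq ha, ih, ih, Finset.sum_powerset_insert ha]
    ring

/-- Bonami's lemma: the fourth moment of a Walsh polynomial of degree at most `d` is at most
`9 ^ d` times the square of its second moment. -/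
lemma sum_walshSum_pow_four_le (U : Finset (Fin n)) (c : Finset (Fin n) → ℝ) (d : ℕ)
    (hc : ∀ S ⊆ U, d < S.card → c S = 0) :
    2 ^ n * ∑ x, walshSum U c x ^ 4 ≤ 9 ^ d * (∑ x, walshSum U c x ^ 2) ^ 2 := by
  induction U using Finset.induction_on generalizing c d with
  | empty =>
    have h9 : (1 : ℝ) ≤ 9 ^ d := one_le_pow₀ (by norm_num)
    simp only [walshSum, walsh, Finset.powerset_empty, Finset.sum_singleton, Finset.prod_empty,
      mul_one, Finset.sum_const, Finset.card_univ, Fintype.card_pi, Fintype.card_bool,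
      Finset.prod_const, Fintype.card_fin, nsmul_eq_mul]
    push_cast
    have hnn : (0 : ℝ) ≤ (2 ^ n * c ∅ ^ 2) ^ 2 := by positivity
    nlinarith
  | insert a U ha ih =>
    rw [sum_walshSum_insert_pow_four ha, sum_walshSum_insert_sq ha]
    have hcard : ∀ S ⊆ U, (insert a S).card = S.card + 1 := fun S hS =>
      Finset.card_insert_of_notMem fun h => ha (hS h)
    have ih₀ := ih c d fun S hS hd => hc S (hS.trans (Finset.subset_insert a U)) hd
    cases d with
    | zero =>
      have hq : ∀ x, walshSum U (fun S => c (insert a S)) x = 0 := fun x =>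
        Finset.sum_eq_zero fun S hS => by
          have hS := Finset.mem_powerset.mp hS
          simp only
          rw [hc (insert a S) (Finset.insert_subset_insert a hS) (by rw [hcard S hS]; omega),
            zero_mul]
      simpa [hq] using ih₀
    | succ d =>
      have ih₁ := ih (fun S => c (insert a S)) d fun S hS hd =>
        hc _ (Finset.insert_subset_insert a hS) (by rw [hcard S hS]; omega)
      have hCS := Finset.sum_mul_sq_le_sq_mul_sq Finset.univ (fun x => walshSum U c x ^ 2)
        fun x => walshSum U (fun S => c (insert a S)) x ^ 2
      simp only [← pow_mul, Nat.reduceMul] at hCS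
      have hA : 0 ≤ ∑ x, walshSum U c x ^ 2 := Finset.sum_nonneg fun x _ => sq_nonneg _
      have hB : 0 ≤ ∑ x, walshSum U (fun S => c (insert a S)) x ^ 2 :=
        Finset.sum_nonneg fun x _ => sq_nonneg _
      have hF₁ : 0 ≤ ∑ x, walshSum U (fun S => c (insert a S)) x ^ 4 :=
        Finset.sum_nonneg fun x _ => by positivity
      set A := ∑ x, walshSum U c x ^ 2
      set B := ∑ x, walshSum U (fun S => c (insert a S)) x ^ 2
      set F₀ := ∑ x, walshSum U c x ^ 4
      set F₁ := ∑ x, walshSum U (fun S => c (insert a S)) x ^ 4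
      set P := ∑ x, walshSum U c x ^ 2 * walshSum U (fun S => c (insert a S)) x ^ 2
      have hP : 2 ^ n * P ≤ 3 * 9 ^ d * (A * B) := by
        refine le_of_sq_le_sq ?_ (by positivity)
        calc (2 ^ n * P) ^ 2 = (2 ^ n) ^ 2 * P ^ 2 := by ring
          _ ≤ (2 ^ n) ^ 2 * (F₀ * F₁) := by gcongr
          _ = (2 ^ n * F₀) * (2 ^ n * F₁) := by ring
          _ ≤ (9 ^ (d + 1) * A ^ 2) * (9 ^ d * B ^ 2) := by gcongr
          _ = (3 * 9 ^ d * (A * B)) ^ 2 := by ring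
      have hD : (0 : ℝ) ≤ 9 ^ d * B ^ 2 := by positivity
      rw [pow_succ] at ih₀ ⊢
      linarith

/-- The `L¹`-`L²` comparison for Walsh polynomials of degree at most `d`. -/
lemma sqrt_sum_sq_le_sum_abs_walshSum (c : Finset (Fin n) → ℝ) (d : ℕ)
    (hc : ∀ S, d < S.card → c S = 0) :
    2 ^ n * √(∑ S, c S ^ 2) ≤ 3 ^ d * ∑ x, |walshSum Finset.univ c x| := by
  have h4 := sum_walshSum_pow_four_le Finset.univ c d fun S _ => hc S
  have h2 := sum_walshSum_sq Finset.univ c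
  rw [Finset.powerset_univ] at h2
  have hCS₁ := Finset.sum_sq_le_sum_mul_sum_of_sq_le_mul Finset.univ
    (r := fun x => walshSum Finset.univ c x ^ 2) (f := fun x => |walshSum Finset.univ c x|)
    (g := fun x => |walshSum Finset.univ c x| ^ 3)
    (fun x _ => by positivity) (fun x _ => by positivity) (fun x _ => by
      rw [← sq_abs (walshSum _ _ _)]; exact le_of_eq (by ring))
  have hCS₂ := Finset.sum_sq_le_sum_mul_sum_of_sq_le_mul Finset.univ
    (r := fun x => |walshSum Finset.univ c x| ^ 3) (f := fun x => walshSum Finset.univ c x ^ 2)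
    (g := fun x => walshSum Finset.univ c x ^ 4)
    (fun x _ => by positivity) (fun x _ => by positivity) (fun x _ => by
      rw [← sq_abs (walshSum _ _ _), ← (show Even 4 by decide).pow_abs (walshSum _ _ _)]
      exact le_of_eq (by ring))
  have hA : 0 ≤ ∑ x, |walshSum Finset.univ c x| := Finset.sum_nonneg fun x _ => abs_nonneg _
  have hB : 0 ≤ ∑ x, walshSum Finset.univ c x ^ 2 := Finset.sum_nonneg fun x _ => sq_nonneg _
  have hC : 0 ≤ ∑ x, |walshSum Finset.univ c x| ^ 3 :=
    Finset.sum_nonneg fun x _ => by positivity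
  set A := ∑ x, |walshSum Finset.univ c x|
  set B := ∑ x, walshSum Finset.univ c x ^ 2
  set C := ∑ x, |walshSum Finset.univ c x| ^ 3
  set F := ∑ x, walshSum Finset.univ c x ^ 4
  have hBA : 2 ^ n * B ≤ 9 ^ d * A ^ 2 := by
    rcases hB.eq_or_lt with h0 | hpos
    · rw [← h0, mul_zero]; positivity
    · refine le_of_mul_le_mul_right ?_ (pow_pos hpos 3)
      calc 2 ^ n * B * B ^ 3 = 2 ^ n * (B ^ 2) ^ 2 := by ring
        _ ≤ 2 ^ n * (A * C) ^ 2 := by gcongr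
        _ = 2 ^ n * (A ^ 2 * C ^ 2) := by ring
        _ ≤ 2 ^ n * (A ^ 2 * (B * F)) := by gcongr
        _ = A ^ 2 * B * (2 ^ n * F) := by ring
        _ ≤ A ^ 2 * B * (9 ^ d * B ^ 2) := by gcongr
        _ = 9 ^ d * A ^ 2 * B ^ 3 := by ring
  refine le_of_sq_le_sq ?_ (by positivity)
  rw [mul_pow, Real.sq_sqrt (Finset.sum_nonneg fun S _ => sq_nonneg _), mul_pow,
    pow_right_comm (3 : ℝ) d 2, show (3 : ℝ) ^ 2 = 9 by norm_num]
  calc _ = 2 ^ n * B := by rw [h2]; ring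
    _ ≤ _ := hBA

lemma abs_le_supNorm (f : (Fin n → Bool) → ℝ) (x : Fin n → Bool) : |f x| ≤ supNorm f :=
  le_ciSup (f := fun x => |f x|) (Set.finite_range _).bddAbove x

lemma supNorm_nonneg (f : (Fin n → Bool) → ℝ) : 0 ≤ supNorm f :=
  (abs_nonneg _).trans (abs_le_supNorm f fun _ => true)

lemma sum_prod_one_add_cubeSign_mul (z : Fin n → ℝ) :
    ∑ x, ∏ i, (1 + cubeSign i x * z i) = 2 ^ n := by
  have h := (Finset.prod_univ_sum (fun _ : Fin n => (Finset.univ : Finset Bool))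
    fun i b => 1 + (if b then (1 : ℝ) else -1) * z i).symm
  rw [Fintype.piFinset_univ] at h
  unfold cubeSign
  rw [h]
  have hsum : ∀ i, ∑ b : Bool, (1 + (if b then (1 : ℝ) else -1) * z i) = 2 := fun i => by
    rw [Fintype.sum_bool, if_pos rfl, if_neg Bool.false_ne_true]
    ring
  simp only [hsum, Finset.prod_const, Finset.card_univ, Fintype.card_fin]

/-- The multiaffine extension of `f` is bounded by `‖f‖_∞` on `[-1,1]^n`. -/
lemma abs_multiaffine_le (f : (Fin n → Bool) → ℝ) (z : Fin n → ℝ) (hz : ∀ i, |z i| ≤ 1) :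
    |∑ S, walshCoeff f S * ∏ i ∈ S, z i| ≤ supNorm f := by
  have hrep : ∑ S, walshCoeff f S * ∏ i ∈ S, z i
      = (∑ x, f x * ∏ i, (1 + cubeSign i x * z i)) / 2 ^ n := by
    simp only [Finset.prod_one_add, Finset.powerset_univ, Finset.mul_sum]
    rw [Finset.sum_comm, Finset.sum_div]
    refine Finset.sum_congr rfl fun S _ => ?_
    rw [walshCoeff, div_mul_eq_mul_div, Finset.sum_mul]
    congr 1
    refine Finset.sum_congr rfl fun x _ => ?_
    rw [Finset.prod_mul_distrib, walsh_eq_prod_cubeSign]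
    ring
  have hpos : ∀ x, 0 ≤ ∏ i, (1 + cubeSign i x * z i) := fun x =>
    Finset.prod_nonneg fun i _ => by
      have h : |cubeSign i x * z i| ≤ 1 := by rw [abs_mul, abs_cubeSign, one_mul]; exact hz i
      linarith [(abs_le.mp h).1]
  rw [hrep, abs_div, abs_of_pos (by positivity : (0 : ℝ) < 2 ^ n), div_le_iff₀ (by positivity)]
  calc |∑ x, f x * ∏ i, (1 + cubeSign i x * z i)|
      ≤ ∑ x, |f x * ∏ i, (1 + cubeSign i x * z i)| := Finset.abs_sum_le_sum_abs _ _
    _ ≤ ∑ x, supNorm f * ∏ i, (1 + cubeSign i x * z i) := by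
        refine Finset.sum_le_sum fun x _ => ?_
        rw [abs_mul, abs_of_nonneg (hpos x)]
        exact mul_le_mul_of_nonneg_right (abs_le_supNorm f x) (hpos x)
    _ = supNorm f * 2 ^ n := by rw [← Finset.mul_sum, sum_prod_one_add_cubeSign_mul]

lemma abs_walshCoeff_le (f : (Fin n → Bool) → ℝ) (S : Finset (Fin n)) :
    |walshCoeff f S| ≤ supNorm f := by
  rw [walshCoeff, abs_div, abs_of_pos (by positivity : (0 : ℝ) < 2 ^ n),
    div_le_iff₀ (by positivity)]
  calc |∑ x, f x * walsh S x| ≤ ∑ x, |f x * walsh S x| := Finset.abs_sum_le_sum_abs _ _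
    _ ≤ ∑ _x : Fin n → Bool, supNorm f := by
        refine Finset.sum_le_sum fun x _ => ?_
        rw [abs_mul, abs_walsh, mul_one]
        exact abs_le_supNorm f x
    _ = supNorm f * 2 ^ n := by simp [mul_comm]

end Cube

/-- Markov's inequality at the endpoint `1`. -/
lemma Polynomial.eval_one_derivative_le_of_abs_le {P : Polynomial ℝ} {d : ℕ} {M : ℝ}
    (hdeg : P.degree ≤ d) (hM : ∀ t ∈ Set.Icc (-1 : ℝ) 1, |P.eval t| ≤ M) :
    P.derivative.eval 1 ≤ d ^ 2 * M := by
  have hM0 : 0 ≤ M := (abs_nonneg _).trans (hM 1 (by norm_num))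
  refine le_of_forall_pos_le_add fun ε hε => ?_
  set δ := ε / (d ^ 2 + 1)
  have hδ : 0 < δ := by positivity
  have hMδ : 0 < M + δ := by linarith
  have h := Polynomial.Chebyshev.eval_iterate_derivative_le_of_forall_abs_le_one
    (n := d) (P := Polynomial.C (M + δ)⁻¹ * P) (k := 1) (x := 1) le_rfl
    ((Polynomial.degree_C_mul (inv_ne_zero hMδ.ne')).trans_le hdeg) (fun t ht => by
      rw [Polynomial.eval_mul, Polynomial.eval_C, abs_mul, abs_of_pos (by positivity),
        inv_mul_le_one₀ hMδ]
      linarith [hM t ht])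
  simp only [Function.iterate_one, Polynomial.derivative_C_mul, Polynomial.eval_mul,
    Polynomial.eval_C, Polynomial.Chebyshev.derivative_T_eval_one] at h
  rw [inv_mul_le_iff₀ hMδ] at h
  have hε' : (d ^ 2 : ℝ) * δ ≤ ε := by
    have : δ * (d ^ 2 + 1) = ε := div_mul_cancel₀ _ (by positivity)
    linarith
  push_cast at h
  linarith

section Mixed

variable {n : ℕ}

lemma sum_walshSum_mem_eq (c : Finset (Fin n) → ℝ) (A : Finset (Fin n)) (x : Fin n → Bool) :
    ∑ i ∈ A, walshSum Finset.univ (fun S => if i ∈ S then c S else 0) x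
      = ∑ S, c S * walsh S x * (S ∩ A).card := by
  unfold walshSum
  rw [Finset.sum_comm, Finset.powerset_univ]
  refine Finset.sum_congr rfl fun S _ => ?_
  simp only [ite_mul, zero_mul]
  rw [← Finset.sum_filter, Finset.sum_const, nsmul_eq_mul, Finset.filter_mem_eq_inter,
    Finset.inter_comm]
  ring

lemma mul_sum_walshSum_mem_le (f : (Fin n → Bool) → ℝ) (d : ℕ)
    (hf : ∀ S : Finset (Fin n), d < S.card → walshCoeff f S = 0) {σ : ℝ} (hσ : |σ| = 1)
    (A : Finset (Fin n)) (x : Fin n → Bool) :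
    σ * ∑ i ∈ A, walshSum Finset.univ (fun S => if i ∈ S then walshCoeff f S else 0) x
      ≤ d ^ 2 * supNorm f := by
  set P : Polynomial ℝ := ∑ S, Polynomial.C (σ * (walshCoeff f S * walsh S x))
    * Polynomial.X ^ (S ∩ A).card with hP
  have hdeg : P.degree ≤ d := by
    refine (Polynomial.degree_sum_le _ _).trans (Finset.sup_le fun S _ => ?_)
    by_cases hS : d < S.card
    · simp [hf S hS]
    · refine (Polynomial.degree_C_mul_X_pow_le _ _).trans ?_
      exact_mod_cast (Finset.card_le_card Finset.inter_subset_left).trans (not_lt.mp hS)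
  have hbound : ∀ t ∈ Set.Icc (-1 : ℝ) 1, |P.eval t| ≤ supNorm f := by
    intro t ht
    have heval : P.eval t = σ * ∑ S, walshCoeff f S
        * ∏ i ∈ S, (cubeSign i x * if i ∈ A then t else 1) := by
      rw [hP, Polynomial.eval_finsetSum, Finset.mul_sum]
      refine Finset.sum_congr rfl fun S _ => ?_
      rw [Finset.prod_mul_distrib, Finset.prod_ite, Finset.prod_const, Finset.prod_const_one,
        Finset.filter_mem_eq_inter, ← walsh_eq_prod_cubeSign]
      simp
      ring
    rw [heval, abs_mul, hσ, one_mul]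
    refine abs_multiaffine_le f _ fun i => ?_
    rw [abs_mul, abs_cubeSign, one_mul]
    split_ifs
    · exact abs_le.mpr ht
    · simp
  have h := Polynomial.eval_one_derivative_le_of_abs_le hdeg hbound
  rw [sum_walshSum_mem_eq, Finset.mul_sum]
  refine le_trans (le_of_eq ?_) h
  rw [hP, Polynomial.derivative_sum, Polynomial.eval_finsetSum]
  refine Finset.sum_congr rfl fun S _ => ?_
  simp [Polynomial.derivative_X_pow]
  ring

lemma sum_abs_walshSum_mem_le (f : (Fin n → Bool) → ℝ) (d : ℕ)
    (hf : ∀ S : Finset (Fin n), d < S.card → walshCoeff f S = 0) (x : Fin n → Bool) :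
    ∑ i, |walshSum Finset.univ (fun S => if i ∈ S then walshCoeff f S else 0) x|
      ≤ 2 * d ^ 2 * supNorm f := by
  set g := fun i => walshSum Finset.univ (fun S => if i ∈ S then walshCoeff f S else 0) x
  have h₁ := mul_sum_walshSum_mem_le f d hf (σ := 1) (by simp)
    (Finset.univ.filter fun i => 0 ≤ g i) x
  have h₂ := mul_sum_walshSum_mem_le f d hf (σ := -1) (by simp)
    (Finset.univ.filter fun i => ¬ 0 ≤ g i) x
  have hsplit := Finset.sum_filter_add_sum_filter_not Finset.univ (fun i => 0 ≤ g i)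
    fun i => |g i|
  have e₁ : ∑ i ∈ Finset.univ.filter (fun i => 0 ≤ g i), |g i|
      = 1 * ∑ i ∈ Finset.univ.filter (fun i => 0 ≤ g i), g i := by
    rw [one_mul]
    exact Finset.sum_congr rfl fun i hi => abs_of_nonneg (Finset.mem_filter.mp hi).2
  have e₂ : ∑ i ∈ Finset.univ.filter (fun i => ¬ 0 ≤ g i), |g i|
      = -1 * ∑ i ∈ Finset.univ.filter (fun i => ¬ 0 ≤ g i), g i := by
    rw [neg_one_mul, ← Finset.sum_neg_distrib]
    exact Finset.sum_congr rfl fun i hi =>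
      abs_of_neg (not_le.mp (Finset.mem_filter.mp hi).2)
  rw [← hsplit, e₁, e₂]
  linarith

/-- The mixed `(ℓ¹, ℓ²)` inequality for the Fourier–Walsh coefficients. -/
lemma sum_sqrt_sum_mem_sq_le (f : (Fin n → Bool) → ℝ) (d : ℕ)
    (hf : ∀ S : Finset (Fin n), d < S.card → walshCoeff f S = 0) :
    ∑ i, √(∑ S with i ∈ S, walshCoeff f S ^ 2) ≤ 3 ^ d * (2 * d ^ 2 * supNorm f) := by
  have h2n : (0 : ℝ) < 2 ^ n := by positivity
  refine le_of_mul_le_mul_left ?_ h2n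
  rw [Finset.mul_sum]
  calc ∑ i, 2 ^ n * √(∑ S with i ∈ S, walshCoeff f S ^ 2)
      ≤ ∑ i, 3 ^ d * ∑ x, |walshSum Finset.univ
          (fun S => if i ∈ S then walshCoeff f S else 0) x| := by
        refine Finset.sum_le_sum fun i _ => ?_
        have h := sqrt_sum_sq_le_sum_abs_walshSum
          (fun S => if i ∈ S then walshCoeff f S else 0) d
          (fun S hS => by simp [hf S hS])
        simpa only [ite_pow, zero_pow two_ne_zero, ← Finset.sum_filter] using h
    _ = 3 ^ d * ∑ x, ∑ i, |walshSum Finset.univ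
          (fun S => if i ∈ S then walshCoeff f S else 0) x| := by
        rw [← Finset.mul_sum, Finset.sum_comm]
    _ ≤ 3 ^ d * ∑ _x : Fin n → Bool, 2 * d ^ 2 * supNorm f := by
        gcongr with x
        exact sum_abs_walshSum_mem_le f d hf x
    _ = 2 ^ n * (3 ^ d * (2 * d ^ 2 * supNorm f)) := by
        simp only [Finset.sum_const, Finset.card_univ, Fintype.card_pi, Fintype.card_bool,
          Finset.prod_const, Fintype.card_fin, nsmul_eq_mul]
        push_cast
        ring

end Mixed

/-- If every nonempty set `U` has an element whose incident weights inside `U` are square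
summable with sum at most `B`, then `∑ a W` is controlled by a mixed `(ℓ¹, ℓ²)` norm of `a`. -/
lemma sum_nonempty_mul_le_of_degenerate {ι : Type*} [Fintype ι] [DecidableEq ι]
    (a W : Finset ι → ℝ) (B : ℝ)
    (hB : ∀ U : Finset ι, U.Nonempty → ∃ i ∈ U, ∑ S ∈ U.powerset with i ∈ S, W S ^ 2 ≤ B)
    (U : Finset ι) :
    ∑ S ∈ U.powerset with S.Nonempty, a S * W S
      ≤ ∑ i ∈ U, √B * √(∑ S with i ∈ S, a S ^ 2) := by
  induction U using Finset.strongInduction with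
  | H U ih =>
    rcases U.eq_empty_or_nonempty with rfl | hU
    · simp [Finset.filter_singleton]
    obtain ⟨i, hi, hiB⟩ := hB U hU
    have hstep := ih (U.erase i) (Finset.erase_ssubset hi)
    rw [← Finset.add_sum_erase U _ hi,
      ← Finset.sum_filter_add_sum_filter_not _ (fun S => i ∈ S)]
    have e₁ : (U.powerset.filter Finset.Nonempty).filter (fun S => i ∈ S)
        = U.powerset.filter (fun S => i ∈ S) := by
      ext S
      simp only [Finset.mem_filter]
      exact ⟨fun h => ⟨h.1.1, h.2⟩, fun h => ⟨⟨h.1, ⟨i, h.2⟩⟩, h.2⟩⟩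
    have e₂ : (U.powerset.filter Finset.Nonempty).filter (fun S => i ∉ S)
        = (U.erase i).powerset.filter Finset.Nonempty := by
      ext S
      simp only [Finset.mem_filter, Finset.mem_powerset, Finset.subset_erase]
      tauto
    rw [e₁, e₂]
    refine add_le_add ?_ hstep
    calc ∑ S ∈ U.powerset with i ∈ S, a S * W S
        ≤ √(∑ S ∈ U.powerset with i ∈ S, a S ^ 2) * √(∑ S ∈ U.powerset with i ∈ S, W S ^ 2) :=
          Real.sum_mul_le_sqrt_mul_sqrt _ _ _
      _ ≤ √(∑ S with i ∈ S, a S ^ 2) * √B := by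
          gcongr
          exact Finset.subset_univ _
      _ = _ := mul_comm _ _

lemma sum_rpow_le_mul_card_rpow (d : ℕ) (hd : 1 ≤ d) (T : Finset ℕ) :
    ∑ k ∈ T, ((k : ℝ) + 1) ^ (1 / (d : ℝ) - 1) ≤ d * (T.card : ℝ) ^ (1 / (d : ℝ)) := by
  have hd0 : (0 : ℝ) < d := by exact_mod_cast hd
  have hd1 : (1 : ℝ) ≤ d := by exact_mod_cast hd
  have hinv1 : 1 / (d : ℝ) ≤ 1 := (div_le_one hd0).mpr hd1
  induction T using Finset.induction_on_max with
  | empty => simp; positivity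
  | insert m T hm ih =>
    have hmT : m ∉ T := fun h => lt_irrefl _ (hm m h)
    rw [Finset.sum_insert hmT, Finset.card_insert_of_notMem hmT]
    have hcard : T.card ≤ m := by
      simpa using Finset.card_le_card (fun k hk => Finset.mem_range.mpr (hm k hk))
    set t : ℝ := (T.card : ℝ) + 1 with ht
    have ht0 : 0 < t := by positivity
    have hmt : ((m : ℝ) + 1) ^ (1 / (d : ℝ) - 1) ≤ t ^ (1 / (d : ℝ) - 1) := by
      refine Real.rpow_le_rpow_of_nonpos ht0 ?_ (by linarith)
      rw [ht]; gcongr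
    have hbern : (T.card : ℝ) ^ (1 / (d : ℝ)) ≤ t ^ (1 / (d : ℝ)) * (1 - 1 / d * t⁻¹) := by
      have ht1 : t⁻¹ ≤ 1 := inv_le_one_of_one_le₀ (by rw [ht]; simp)
      have h := rpow_one_add_le_one_add_mul_self (s := -t⁻¹) (by linarith)
        (p := 1 / (d : ℝ)) (by positivity) hinv1
      have hfac : (T.card : ℝ) = t * (1 + -t⁻¹) := by
        rw [mul_add, mul_one, mul_neg, mul_inv_cancel₀ ht0.ne', ht]; ring
      rw [hfac, Real.mul_rpow ht0.le (by linarith)]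
      exact mul_le_mul_of_nonneg_left (by linarith) (Real.rpow_nonneg ht0.le _)
    have hpow : t ^ (1 / (d : ℝ) - 1) = t ^ (1 / (d : ℝ)) * t⁻¹ := by
      rw [Real.rpow_sub ht0, Real.rpow_one, div_eq_mul_inv]
    have hmul : (d : ℝ) * (t ^ (1 / (d : ℝ)) * (1 - 1 / d * t⁻¹))
        = d * t ^ (1 / (d : ℝ)) - t ^ (1 / (d : ℝ)) * t⁻¹ := by
      field_simp
    have := mul_le_mul_of_nonneg_left hbern hd0.le
    rw [Nat.cast_add_one, ← ht]
    linarith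

lemma card_powerset_filter_card_le {ι : Type*} (U : Finset ι) (d : ℕ) :
    (U.powerset.filter fun S => S.card ≤ d).card ≤ (U.card + 1) ^ d := by
  classical
  have hsub : U.powerset.filter (fun S => S.card ≤ d)
      ⊆ (Finset.range (d + 1)).biUnion fun m => U.powersetCard m := by
    intro S hS
    simp only [Finset.mem_filter, Finset.mem_powerset] at hS
    simp only [Finset.mem_biUnion, Finset.mem_range, Finset.mem_powersetCard]
    exact ⟨S.card, by omega, hS.1, rfl⟩
  refine (Finset.card_le_card hsub).trans (Finset.card_biUnion_le.trans ?_)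
  rw [add_pow]
  refine Finset.sum_le_sum fun m hm => ?_
  rw [Finset.card_powersetCard, one_pow, mul_one]
  exact (Nat.choose_le_pow _ _).trans
    (Nat.le_mul_of_pos_right _ (Nat.choose_pos (Nat.lt_succ_iff.mp (Finset.mem_range.mp hm))))

/-- The weights of the Lorentz norm, transported along an injective enumeration `κ` of the
sets of size at most `d`, satisfy the degeneracy condition with constant `2 d ^ 2`. -/
lemma exists_mem_sum_weight_sq_le {ι : Type*} [DecidableEq ι] (d : ℕ) (hd : 1 ≤ d)
    (W : Finset ι → ℝ) (κ : Finset ι → ℕ) (hκ : Set.InjOn κ {S | S.card ≤ d})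
    (hW : ∀ S, S.card ≤ d → W S ^ 2 = ((κ S : ℝ) + 1) ^ (1 / (d : ℝ) - 1))
    (hW0 : ∀ S, d < S.card → W S = 0) (U : Finset ι) (hU : U.Nonempty) :
    ∃ i ∈ U, ∑ S ∈ U.powerset with i ∈ S, W S ^ 2 ≤ 2 * d ^ 2 := by
  have hu : (1 : ℝ) ≤ U.card := by exact_mod_cast hU.card_pos
  have htotal : ∑ S ∈ U.powerset, W S ^ 2 ≤ d * (U.card + 1) := by
    have h0 : ∑ S ∈ U.powerset, W S ^ 2
        = ∑ S ∈ U.powerset with S.card ≤ d, W S ^ 2 := by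
      rw [Finset.sum_filter]
      refine Finset.sum_congr rfl fun S _ => ?_
      split_ifs with h
      · rfl
      · rw [hW0 S (not_le.mp h)]; norm_num
    have hinj : Set.InjOn κ (U.powerset.filter fun S => S.card ≤ d) := by
      refine hκ.mono fun S hS => ?_
      exact (Finset.mem_filter.mp (Finset.mem_coe.mp hS)).2
    rw [h0, Finset.sum_congr rfl fun S hS => hW S (Finset.mem_filter.mp hS).2,
      ← Finset.sum_image (f := fun k : ℕ => ((k : ℝ) + 1) ^ (1 / (d : ℝ) - 1)) hinj]
    refine (sum_rpow_le_mul_card_rpow d hd _).trans ?_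
    rw [Finset.card_image_of_injOn hinj]
    gcongr
    calc ((U.powerset.filter fun S => S.card ≤ d).card : ℝ) ^ (1 / (d : ℝ))
        ≤ (((U.card : ℝ) + 1) ^ d) ^ (1 / (d : ℝ)) := by
          gcongr
          exact_mod_cast card_powerset_filter_card_le U d
      _ = U.card + 1 := by
          rw [one_div, Real.pow_rpow_inv_natCast (by positivity) (by omega)]
  have hdouble : ∑ i ∈ U, ∑ S ∈ U.powerset with i ∈ S, W S ^ 2
      ≤ d * ∑ S ∈ U.powerset, W S ^ 2 := by
    simp only [Finset.sum_filter]
    rw [Finset.sum_comm, Finset.mul_sum]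
    refine Finset.sum_le_sum fun S hS => ?_
    rw [← Finset.sum_filter, Finset.sum_const, nsmul_eq_mul, Finset.filter_mem_eq_inter,
      Finset.inter_eq_right.mpr (Finset.mem_powerset.mp hS)]
    rcases le_or_gt S.card d with h | h
    · gcongr
    · rw [hW0 S h]; norm_num
  refine Finset.exists_le_of_sum_le hU ?_
  rw [Finset.sum_const, nsmul_eq_mul]
  calc _ ≤ d * (d * ((U.card : ℝ) + 1)) := hdouble.trans (by gcongr)
    _ ≤ d * (d * (U.card + U.card)) := by gcongr
    _ = _ := by ring

lemma sum_abs_walshCoeff_mul_weight_le {n d : ℕ} (f : (Fin n → Bool) → ℝ)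
    (hf : ∀ S : Finset (Fin n), d < S.card → walshCoeff f S = 0)
    (W : Finset (Fin n) → ℝ) (κ : Finset (Fin n) → ℕ) (hκ : Set.InjOn κ {S | S.card ≤ d})
    (hW : ∀ S, S.card ≤ d → W S = ((κ S : ℝ) + 1) ^ (-((d : ℝ) - 1) / (2 * d)))
    (hW0 : ∀ S, d < S.card → W S = 0) :
    ∑ S, |walshCoeff f S| * W S ≤ 200 ^ d * supNorm f := by
  have hM := supNorm_nonneg f
  have hempty : |walshCoeff f ∅| * W ∅ ≤ supNorm f := by
    have h1 : W ∅ ≤ 1 := by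
      rw [hW ∅ (by simp)]
      refine Real.rpow_le_one_of_one_le_of_nonpos (by simp) ?_
      rcases Nat.eq_zero_or_pos d with rfl | h
      · simp
      · have : (1 : ℝ) ≤ d := by exact_mod_cast h
        exact div_nonpos_of_nonpos_of_nonneg (by linarith) (by positivity)
    exact (mul_le_of_le_one_right (abs_nonneg _) h1).trans (abs_walshCoeff_le f ∅)
  have hsplit : ∑ S, |walshCoeff f S| * W S = |walshCoeff f ∅| * W ∅
      + ∑ S ∈ (Finset.univ : Finset (Fin n)).powerset with S.Nonempty,
        |walshCoeff f S| * W S := by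
    rw [← Finset.add_sum_erase _ _ (Finset.mem_univ ∅)]
    congr 1
    refine Finset.sum_congr ?_ fun _ _ => rfl
    ext S
    simp [Finset.nonempty_iff_ne_empty]
  rw [hsplit]
  rcases Nat.eq_zero_or_pos d with rfl | hd
  · rw [Finset.sum_eq_zero (s := Finset.filter _ _) fun S hS => by
      rw [hW0 S (Finset.mem_filter.mp hS).2.card_pos, mul_zero]]
    simpa using hempty
  · have hd0 : (0 : ℝ) < d := by exact_mod_cast hd
    have hWsq : ∀ S, S.card ≤ d → W S ^ 2 = ((κ S : ℝ) + 1) ^ (1 / (d : ℝ) - 1) := by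
      intro S hS
      rw [hW S hS, ← Real.rpow_natCast, ← Real.rpow_mul (by positivity)]
      congr 1
      push_cast
      field_simp
      ring
    have hmain := sum_nonempty_mul_le_of_degenerate (fun S => |walshCoeff f S|) W (2 * d ^ 2)
      (exists_mem_sum_weight_sq_le d hd W κ hκ hWsq hW0) Finset.univ
    simp only [sq_abs] at hmain
    rw [← Finset.mul_sum] at hmain
    have hsqrt : √(2 * (d : ℝ) ^ 2) ≤ 2 * d := by
      refine Real.sqrt_le_iff.mpr ⟨by positivity, ?_⟩
      nlinarith [sq_nonneg (d : ℝ)]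
    have hd2 : (d : ℝ) ≤ 2 ^ d := by exact_mod_cast Nat.lt_two_pow_self.le
    have h4 : (4 : ℝ) ≤ 4 ^ d := le_self_pow₀ (by norm_num) (by omega)
    have h2 : (2 : ℝ) ≤ 2 ^ d := le_self_pow₀ (by norm_num) (by omega)
    have hconst : 2 * (d : ℝ) * (3 ^ d * (2 * d ^ 2)) ≤ 100 ^ d := by
      calc 2 * (d : ℝ) * (3 ^ d * (2 * d ^ 2)) = 4 * 3 ^ d * d ^ 3 := by ring
        _ ≤ 4 ^ d * 3 ^ d * (2 ^ d) ^ 3 := by gcongr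
        _ = (4 * 3 * 2 ^ 3) ^ d := by rw [← pow_mul, mul_comm d 3, pow_mul, mul_pow, mul_pow]
        _ ≤ 100 ^ d := by gcongr; norm_num
    calc _ ≤ supNorm f + 2 * d * (3 ^ d * (2 * d ^ 2 * supNorm f)) := by
          refine add_le_add hempty (hmain.trans ?_)
          exact mul_le_mul hsqrt (sum_sqrt_sum_mem_sq_le f d hf)
            (Finset.sum_nonneg fun i _ => Real.sqrt_nonneg _) (by positivity)
      _ = (1 + 2 * (d : ℝ) * (3 ^ d * (2 * d ^ 2))) * supNorm f := by ring
      _ ≤ (2 * 100 ^ d) * supNorm f := by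
          gcongr
          linarith [one_le_pow₀ (M₀ := ℝ) (a := 100) (n := d) (by norm_num)]
      _ ≤ (2 ^ d * 100 ^ d) * supNorm f := by gcongr
      _ = 200 ^ d * supNorm f := by rw [← mul_pow]; norm_num

/-- Lorentz-norm Bohnenblust–Hille inequality: there is `L ≥ 1` such that for every function
`f` of degree at most `d` on `{-1,1}^n`, the decreasing rearrangement `f*` of the family
`(|f̂(S)|)_{|S| ≤ d}` (indexed by `Fin D(n,d)`, `D(n,d) = ∑_{m=0}^d C(n,m)`, via any
enumeration `e` making the values nonincreasing) satisfies
`∑_{k=1}^{D(n,d)} f*(k) k^{-(d-1)/(2d)} ≤ L^d ‖f‖_∞`. -/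
theorem lorentz_bh_boolean :
    ∃ L : ℝ, 1 ≤ L ∧ ∀ (n d : ℕ) (f : (Fin n → Bool) → ℝ),
      (∀ S : Finset (Fin n), d < S.card → walshCoeff f S = 0) →
      ∀ e : Fin (∑ m ∈ Finset.range (d + 1), n.choose m) ≃
          {S : Finset (Fin n) // S.card ≤ d},
        (∀ i j, i ≤ j → |walshCoeff f (e j : Finset (Fin n))|
            ≤ |walshCoeff f (e i : Finset (Fin n))|) →
        ∑ k : Fin (∑ m ∈ Finset.range (d + 1), n.choose m),
            |walshCoeff f (e k : Finset (Fin n))| * ((k : ℝ) + 1) ^ (-((d : ℝ) - 1) / (2 * d))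
          ≤ L ^ d * supNorm f := by
  refine ⟨200, by norm_num, fun n d f hf e _ => ?_⟩
  let κ : Finset (Fin n) → ℕ := fun S => if h : S.card ≤ d then (e.symm ⟨S, h⟩ : ℕ) else 0
  let W : Finset (Fin n) → ℝ := fun S =>
    if S.card ≤ d then ((κ S : ℝ) + 1) ^ (-((d : ℝ) - 1) / (2 * d)) else 0
  have hκ : Set.InjOn κ {S | S.card ≤ d} := by
    intro S hS T hT hST
    simp only [Set.mem_ofPred_eq] at hS hT
    simp only [κ, dif_pos hS, dif_pos hT] at hST
    simpa using e.symm.injective (Fin.ext hST)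
  have h := sum_abs_walshCoeff_mul_weight_le f hf W κ hκ (fun S hS => if_pos hS)
    fun S hS => if_neg (not_le.mpr hS)
  refine le_trans (le_of_eq ?_) h
  rw [← Equiv.sum_comp e.symm]
  simp only [Equiv.apply_symm_apply]
  have hsub : ∑ S with S.card ≤ d, |walshCoeff f S| * W S = ∑ S, |walshCoeff f S| * W S :=
    Finset.sum_subset (Finset.subset_univ _) fun S _ hS => by
      have hS' : ¬ S.card ≤ d := fun h => hS (Finset.mem_filter.mpr ⟨Finset.mem_univ S, h⟩)
      simp only [W, if_neg hS', mul_zero]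
  rw [← hsub, Finset.sum_subtype (p := fun S : Finset (Fin n) => S.card ≤ d) _ (by simp)]
  refine Finset.sum_congr rfl fun S _ => ?_
  simp [W, κ, S.2]
end

section
/- Let d, n ∈ ℕ with d ≤ n, let α ≥ 0, and let f : {-1,1}^n → [-1,1] be a function of degree at most d such that f̂(S) ∈ {α, −α} for every S ⊆ [n] with |S| ≤ d. Suppose C > 0 is a constant such that (∑_{|S| ≤ d} |ĝ(S)|^{2d/(d+1)})^{(d+1)/(2d)} ≤ C · ‖g‖_∞ for every function g : {-1,1}^n → ℝ of degree at most d. Then Var(f)² / max_{1 ≤ j ≤ n} Inf_j(f) ≤ d · C². -/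
open Finset

/-- The variance `Var(f) = ∑_{S ≠ ∅} f̂(S)²`. -/
noncomputable def variance {n : ℕ} (f : (Fin n → Bool) → ℝ) : ℝ :=
  ∑ S ∈ Finset.univ.filter (fun S : Finset (Fin n) => S ≠ ∅), (walshCoeff f S) ^ 2

/-- The influence of coordinate `j`: `Inf_j(f) = ∑_{S ∋ j} f̂(S)²`. -/
noncomputable def influence {n : ℕ} (j : Fin n) (f : (Fin n → Bool) → ℝ) : ℝ :=
  ∑ S ∈ Finset.univ.filter (fun S : Finset (Fin n) => j ∈ S), (walshCoeff f S) ^ 2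

/-- The classical lower bound `(n / d) ^ d ≤ n.choose d`, cleared of denominators. -/
theorem pow_le_pow_mul_choose (d n : ℕ) (hdn : d ≤ n) : n ^ d ≤ d ^ d * n.choose d := by
  induction d generalizing n with
  | zero => simp
  | succ d ih =>
    obtain ⟨m, rfl⟩ : ∃ m, n = m + 1 := ⟨n - 1, by omega⟩
    have hdm : d ≤ m := by omega
    rcases Nat.eq_zero_or_pos d with rfl | hd
    · simp
    have hscale : d * (m + 1) ≤ (d + 1) * m := by nlinarith
    have key : d ^ d * (m + 1) ^ d ≤ d ^ d * ((d + 1) ^ d * m.choose d) :=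
      calc d ^ d * (m + 1) ^ d = (d * (m + 1)) ^ d := (mul_pow _ _ _).symm
        _ ≤ ((d + 1) * m) ^ d := Nat.pow_le_pow_left hscale d
        _ = (d + 1) ^ d * m ^ d := mul_pow _ _ _
        _ ≤ (d + 1) ^ d * (d ^ d * m.choose d) := Nat.mul_le_mul_left _ (ih m hdm)
        _ = d ^ d * ((d + 1) ^ d * m.choose d) := by ring
    have key' := Nat.le_of_mul_le_mul_left key (by positivity)
    calc (m + 1) ^ (d + 1) = (m + 1) ^ d * (m + 1) := pow_succ _ _
      _ ≤ (d + 1) ^ d * m.choose d * (m + 1) := Nat.mul_le_mul_right _ key'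
      _ = (d + 1) ^ d * ((m + 1) * m.choose d) := by ring
      _ = (d + 1) ^ d * ((m + 1).choose (d + 1) * (d + 1)) := by
        rw [Nat.add_one_mul_choose_eq]
      _ = (d + 1) ^ (d + 1) * (m + 1).choose (d + 1) := by ring

/-- The Poincaré inequality on the discrete cube. -/
theorem variance_le_sum_influence {n : ℕ} (f : (Fin n → Bool) → ℝ) :
    variance f ≤ ∑ j, influence j f := by
  have hswap : ∑ j, influence j f
      = ∑ S : Finset (Fin n), (S.card : ℝ) * walshCoeff f S ^ 2 := by
    simp only [influence, Finset.sum_filter]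
    rw [Finset.sum_comm]
    refine Finset.sum_congr rfl fun S _ => ?_
    rw [← Finset.sum_filter]
    simp
  rw [hswap, variance, Finset.sum_filter]
  refine Finset.sum_le_sum fun S _ => ?_
  split_ifs with hS
  · have hcard : (1 : ℝ) ≤ S.card := by
      exact_mod_cast Finset.card_pos.mpr (Finset.nonempty_iff_ne_empty.mpr hS)
    nlinarith [sq_nonneg (walshCoeff f S)]
  · positivity

theorem influence_nonneg {n : ℕ} (j : Fin n) (f : (Fin n → Bool) → ℝ) : 0 ≤ influence j f :=
  Finset.sum_nonneg fun _ _ => sq_nonneg _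

theorem variance_nonneg {n : ℕ} (f : (Fin n → Bool) → ℝ) : 0 ≤ variance f :=
  Finset.sum_nonneg fun _ _ => sq_nonneg _

theorem variance_le_mul_iSup_influence {n : ℕ} (f : (Fin n → Bool) → ℝ) :
    variance f ≤ n * ⨆ j, influence j f :=
  calc variance f ≤ ∑ j, influence j f := variance_le_sum_influence f
    _ ≤ ∑ _j : Fin n, ⨆ j, influence j f :=
      Finset.sum_le_sum fun j _ =>
        le_ciSup (f := fun j => influence j f) (Set.finite_range _).bddAbove j
    _ = n * ⨆ j, influence j f := by simp

theorem variance_sq_div_iSup_influence_le {n : ℕ} (f : (Fin n → Bool) → ℝ) :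
    variance f ^ 2 / (⨆ j, influence j f) ≤ n * variance f := by
  refine div_le_of_le_mul₀ (Real.iSup_nonneg fun j => influence_nonneg j f)
    (mul_nonneg n.cast_nonneg (variance_nonneg f)) ?_
  nlinarith [mul_le_mul_of_nonneg_left (variance_le_mul_iSup_influence f) (variance_nonneg f)]

theorem variance_le_card_mul_sq {n d : ℕ} {α : ℝ} (f : (Fin n → Bool) → ℝ)
    (hdeg : ∀ S : Finset (Fin n), d < S.card → walshCoeff f S = 0)
    (habs : ∀ S : Finset (Fin n), S.card ≤ d → |walshCoeff f S| = α) :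
    variance f ≤ (#{S : Finset (Fin n) | S.card ≤ d} : ℝ) * α ^ 2 := by
  rw [variance, ← nsmul_eq_mul, ← Finset.sum_const, Finset.sum_filter, Finset.sum_filter]
  refine Finset.sum_le_sum fun S _ => ?_
  by_cases hS : S.card ≤ d
  · rw [if_pos hS, ← habs S hS, sq_abs]
    split_ifs
    · exact le_rfl
    · positivity
  · simp [hdeg S (not_le.mp hS), hS]

theorem choose_le_card_filter_card_le (n d : ℕ) :
    n.choose d ≤ #{S : Finset (Fin n) | S.card ≤ d} := by
  calc n.choose d = #(Finset.powersetCard d (univ : Finset (Fin n))) := by simp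
    _ ≤ _ := Finset.card_le_card fun S hS => by
      simp [(Finset.mem_powersetCard.mp hS).2]

/-- Number of low-degree characters against the dimension: `n ≤ d N ^ (1 / d)`. -/
theorem le_mul_card_filter_rpow {n d : ℕ} (hd : 0 < d) (hdn : d ≤ n) :
    (n : ℝ) ≤ d * (#{S : Finset (Fin n) | S.card ≤ d} : ℝ) ^ (1 / d : ℝ) := by
  set N := #{S : Finset (Fin n) | S.card ≤ d}
  have hnat : n ^ d ≤ d ^ d * N :=
    (pow_le_pow_mul_choose d n hdn).trans
      (Nat.mul_le_mul_left _ (choose_le_card_filter_card_le n d))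
  refine le_of_pow_le_pow_left₀ hd.ne' (by positivity) ?_
  rw [mul_pow, one_div, Real.rpow_inv_natCast_pow N.cast_nonneg hd.ne']
  exact_mod_cast hnat

/-- If the degree-`d` function `f : {-1,1}^n → [-1,1]` has all Fourier coefficients on levels
`≤ d` equal to `±α`, and `C` is a Bohnenblust–Hille constant for degree-`d` functions on
`{-1,1}^n`, then `Var(f)² / max_j Inf_j(f) ≤ d C²`. -/
theorem aaronson_ambainis_flat_coefficients (d n : ℕ) (hn : 0 < n) (hdn : d ≤ n)
    (α : ℝ) (hα : 0 ≤ α) (f : (Fin n → Bool) → ℝ)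
    (hrange : ∀ x, f x ∈ Set.Icc (-1 : ℝ) 1)
    (hdeg : ∀ S : Finset (Fin n), d < S.card → walshCoeff f S = 0)
    (hflat : ∀ S : Finset (Fin n), S.card ≤ d →
      walshCoeff f S = α ∨ walshCoeff f S = -α)
    (C : ℝ) (hC : 0 < C)
    (hBH : ∀ g : (Fin n → Bool) → ℝ,
      (∀ S : Finset (Fin n), d < S.card → walshCoeff g S = 0) →
      (∑ S ∈ Finset.univ.filter (fun S : Finset (Fin n) => S.card ≤ d),
          |walshCoeff g S| ^ ((2 * d : ℝ) / (d + 1))) ^ ((d + 1 : ℝ) / (2 * d))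
        ≤ C * ⨆ x : Fin n → Bool, |g x|) :
    variance f ^ 2 / (⨆ j : Fin n, influence j f) ≤ d * C ^ 2 := by
  have habs : ∀ S : Finset (Fin n), S.card ≤ d → |walshCoeff f S| = α := fun S hS => by
    rcases hflat S hS with h | h <;> simp [h, abs_of_nonneg hα]
  have hvar := variance_le_card_mul_sq f hdeg habs
  refine (variance_sq_div_iSup_influence_le f).trans ?_
  rcases Nat.eq_zero_or_pos d with rfl | hd
  · have hzero : variance f = 0 := Finset.sum_eq_zero fun S hS => by
      rw [hdeg S (Finset.card_pos.mpr (Finset.nonempty_iff_ne_empty.mpr (by simpa using hS)))]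
      simp
    simp [hzero]
  have hdim := le_mul_card_filter_rpow hd hdn
  have hBHf := hBH f hdeg
  rw [Finset.sum_congr rfl fun S hS => by rw [habs S (Finset.mem_filter.mp hS).2],
    Finset.sum_const, nsmul_eq_mul] at hBHf
  set N := #{S : Finset (Fin n) | S.card ≤ d}
  have hN : 0 < (N : ℝ) := Nat.cast_pos.mpr (Finset.card_pos.mpr ⟨∅, by simp⟩)
  have hd' : (0 : ℝ) < d := Nat.cast_pos.mpr hd
  have hsup : ⨆ x, |f x| ≤ 1 := ciSup_le fun x => abs_le.mpr (hrange x)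
  have hα_le : (N : ℝ) ^ ((d + 1 : ℝ) / (2 * d)) * α ≤ C := by
    rw [Real.mul_rpow hN.le (by positivity), ← Real.rpow_mul hα,
      show (2 * d : ℝ) / (d + 1) * ((d + 1) / (2 * d)) = 1 by field_simp, Real.rpow_one] at hBHf
    nlinarith
  have hpow : ((N : ℝ) ^ ((d + 1 : ℝ) / (2 * d))) ^ 2 = N ^ (1 / d : ℝ) * N := by
    rw [← Real.rpow_natCast, ← Real.rpow_mul hN.le, ← Real.rpow_add_one hN.ne']
    congr 1
    push_cast
    field_simp
    ring
  calc n * variance f ≤ (d * (N : ℝ) ^ (1 / d : ℝ)) * (N * α ^ 2) := by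
        gcongr
        exact variance_nonneg f
    _ = d * ((N : ℝ) ^ ((d + 1 : ℝ) / (2 * d)) * α) ^ 2 := by rw [mul_pow, hpow]; ring
    _ ≤ d * C ^ 2 := by gcongr
end
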